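/- For every nonzero ideal I of 𝓞_𝕜 whose class in the ideal class group of 𝓞_𝕜 has order a power of 2, the ideal I·𝓞_{L₁} generated by the image of I in the ring of integers of L₁ is principal (the 2-class group of 𝕜 capitulates completely in L₁). -/

import Mathlib

/-- If `x` is odd in every solution of `x² - d y² = 1`, the fundamental solution splits `d` as a
product `a * b` with `b v² - a u² = 1` and `a ≠ d`. -/
theorem Pell.exists_mul_eq_sub_eq_one {d : ℤ} (h₀ : 0 < d) (hd : ¬ IsSquare d)
    (hodd : ∀ x y : ℤ, x ^ 2 - d * y ^ 2 = 1 → Odd x ∧ Even y) :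
    ∃ a b u v : ℤ, 0 < a ∧ 0 < b ∧ a * b = d ∧ b * v ^ 2 - a * u ^ 2 = 1 ∧ b ≠ 1 := by
  obtain ⟨s, hs⟩ := Pell.IsFundamental.exists_of_not_isSquare h₀ hd
  have hprop := s.prop
  obtain ⟨hx, hy⟩ := hodd _ _ hprop
  obtain ⟨m, hm⟩ := hx
  obtain ⟨n, hn⟩ := hy
  have hx1 := hs.1
  have hm0 : 0 < m := by omega
  have hmn : m * (m + 1) = d * n ^ 2 := by
    rw [hm, hn] at hprop
    nlinarith
  have hcop : IsCoprime m (m + 1) := ⟨-1, 1, by ring⟩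
  obtain ⟨a, b, ha, hb, hab⟩ := exists_dvd_and_dvd_of_dvd_mul (Dvd.intro _ hmn.symm)
  wlog ha0 : 0 < a generalizing a b
  · refine this (-a) (-b) (by simpa using ha) (by simpa using hb) (by simpa using hab) ?_
    rcases lt_trichotomy a 0 with h | h | h
    · omega
    · subst h; simp at hab; omega
    · exact absurd h ha0
  have hb0 : 0 < b := by
    by_contra hcon
    nlinarith
  obtain ⟨a', ha'⟩ := ha
  obtain ⟨b', hb'⟩ := hb
  have ha'0 : 0 < a' := by
    by_contra hcon
    nlinarith
  have hb'0 : 0 < b' := by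
    by_contra hcon
    nlinarith
  have hprod : a' * b' = n ^ 2 := by
    have : d * (a' * b') = d * n ^ 2 := by
      rw [← hmn, hb', hab, ha']
      ring
    exact mul_left_cancel₀ h₀.ne' this
  have hcop' : IsCoprime a' b' := by
    rw [hb'] at hcop
    nth_rewrite 1 [ha'] at hcop
    exact hcop.of_mul_left_right.of_mul_right_right
  obtain ⟨u, hu⟩ := Int.sq_of_isCoprime hcop' hprod
  obtain ⟨v, hv⟩ := Int.sq_of_isCoprime hcop'.symm (by rw [mul_comm]; exact hprod)
  have hu : a' = u ^ 2 := hu.resolve_right (by nlinarith [sq_nonneg u])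
  have hv : b' = v ^ 2 := hv.resolve_right (by nlinarith [sq_nonneg v])
  refine ⟨a, b, u, v, ha0, hb0, hab.symm, by rw [← hu, ← hv]; linarith, ?_⟩
  rintro rfl
  have had : d = a := by simpa using hab
  subst had
  have hsol : |v| ^ 2 - d * u ^ 2 = 1 := by rw [sq_abs, ← hu, ← hv]; linarith
  have hv2 : |v| ^ 2 = m + 1 := by rw [sq_abs, ← hv]; linarith
  have hv1 : 1 < |v| := by
    by_contra hcon
    nlinarith [abs_nonneg v]
  have hle := @hs.2.2 (Pell.Solution₁.mk |v| u hsol) (by simpa using hv1)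
  simp only [Pell.Solution₁.x_mk] at hle
  nlinarith

theorem Pell.odd_even_of_mod_four {d x y : ℤ} (hd : d % 4 = 1 ∨ d % 4 = 2)
    (h : x ^ 2 - d * y ^ 2 = 1) : Odd x ∧ Even y := by
  have hx : x % 4 = 0 ∨ x % 4 = 1 ∨ x % 4 = 2 ∨ x % 4 = 3 := by omega
  have h1 : (x ^ 2 - d * y ^ 2) % 4 = 1 := by rw [h]; rfl
  have hy : y % 4 = 0 ∨ y % 4 = 1 ∨ y % 4 = 2 ∨ y % 4 = 3 := by omega
  rw [Int.odd_iff, Int.even_iff]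
  rcases hd with hd | hd <;> rcases hx with hx | hx | hx | hx <;>
    rcases hy with hy | hy | hy | hy <;>
    simp [Int.sub_emod, Int.mul_emod, pow_two, hx, hy, hd] at h1 <;> omega

theorem Int.not_isSquare_mul_of_prime {p m : ℤ} (hp : Prime p) (hm : ¬ p ∣ m) :
    ¬ IsSquare (p * m) := by
  rintro ⟨r, hr⟩
  have hpr : p ∣ r := by
    have : p ∣ r * r := ⟨m, hr.symm⟩
    exact (hp.dvd_or_dvd this).elim id id
  obtain ⟨t, rfl⟩ := hpr
  apply hm
  refine ⟨t * t, mul_left_cancel₀ hp.ne_zero ?_⟩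
  rw [hr]; ring

theorem Prime.eq_mul_or_eq_mul_of_mul_eq {R : Type*} [CommRing R] [IsDomain R] {p a b m : R}
    (hp : Prime p) (h : a * b = p * m) :
    (∃ a', a = p * a' ∧ a' * b = m) ∨ ∃ b', b = p * b' ∧ a * b' = m := by
  rcases hp.dvd_or_dvd (Dvd.intro _ h.symm) with ⟨c, rfl⟩ | ⟨c, rfl⟩
  · exact Or.inl ⟨c, rfl, mul_left_cancel₀ hp.ne_zero (by rw [← h]; ring)⟩
  · exact Or.inr ⟨c, rfl, mul_left_cancel₀ hp.ne_zero (by rw [← h]; ring)⟩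

theorem exists_sq_add_one_eq_mul_sq_of_prime {p : ℕ} (hp : p.Prime) (hm : p % 4 = 1) :
    ∃ x y : ℤ, x ^ 2 + 1 = p * y ^ 2 := by
  have hpi : Prime (p : ℤ) := Nat.prime_iff_prime_int.mp hp
  have hsq : ¬ IsSquare (p : ℤ) := by
    have := Int.not_isSquare_mul_of_prime hpi (m := 1) (fun h => hpi.not_isUnit (isUnit_of_dvd_one h))
    simpa using this
  obtain ⟨a, b, u, v, ha, hb, hab, h, hb1⟩ := Pell.exists_mul_eq_sub_eq_one
    (d := p) (by exact_mod_cast hp.pos) hsq (fun x y => Pell.odd_even_of_mod_four (by omega))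
  have ha1 : a = 1 := by
    rcases hpi.irreducible.isUnit_or_isUnit hab.symm with h' | h'
    · rcases Int.isUnit_iff.mp h' with h' | h' <;> omega
    · rcases Int.isUnit_iff.mp h' with h' | h' <;> omega
  subst ha1
  rw [one_mul] at hab
  subst hab
  exact ⟨u, v, by linarith⟩

theorem legendreSym_eq_one_of_mul_sq {p : ℕ} [Fact p.Prime] {b v k : ℤ}
    (h : b * v ^ 2 - p * k = 1) : legendreSym p b = 1 := by
  have h1 : ((b : ZMod p)) * (v : ZMod p) ^ 2 = 1 := by
    have := congrArg (Int.cast : ℤ → ZMod p) h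
    push_cast at this
    simpa using this
  have hv : (v : ZMod p) ≠ 0 := by
    rintro h0
    simp [h0] at h1
  have h2 : legendreSym p (b * v ^ 2) = 1 := by
    rw [legendreSym]; push_cast; rw [h1]; simp
  rwa [legendreSym.mul, legendreSym.sq_one' _ hv, mul_one] at h2

theorem legendreSym_two_of_mod_eight_eq_five {p : ℕ} [Fact p.Prime] (hm : p % 8 = 5) :
    legendreSym p 2 = -1 := by
  rw [legendreSym.eq_neg_one_iff]
  push_cast
  rw [ZMod.exists_sq_eq_two_iff (by rintro rfl; simp at hm)]
  omega

theorem legendreSym_neg_one_of_mod_eight_eq_five {p : ℕ} [Fact p.Prime] (hm : p % 8 = 5) :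
    legendreSym p (-1) = 1 := by
  rw [legendreSym.at_neg_one (by rintro rfl; simp at hm), ZMod.χ₄_nat_one_mod_four (by omega)]

theorem legendreSym_of_neg_mul_sq {p : ℕ} [Fact p.Prime] (hm : p % 8 = 5) {a u k : ℤ}
    (h : p * k - a * u ^ 2 = 1) : legendreSym p a = 1 := by
  have := legendreSym_eq_one_of_mul_sq (p := p) (b := (-1) * a) (v := u) (k := -k) (by linarith)
  rwa [legendreSym.mul, legendreSym_neg_one_of_mod_eight_eq_five hm, one_mul] at this

theorem exists_sq_add_one_eq_two_mul_mul_sq {p q : ℕ} (hp : p.Prime) (hq : q.Prime)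
    (hmp : p % 8 = 5) (hmq : q % 8 = 5) :
    ∃ x y : ℤ, x ^ 2 + 1 = 2 * p * q * y ^ 2 := by
  have := Fact.mk hp
  have := Fact.mk hq
  have hpi : Prime (p : ℤ) := Nat.prime_iff_prime_int.mp hp
  have hqi : Prime (q : ℤ) := Nat.prime_iff_prime_int.mp hq
  have hodd : (p * q : ℤ) % 2 = 1 := by
    rw [Int.mul_emod, show (p : ℤ) % 2 = 1 by omega, show (q : ℤ) % 2 = 1 by omega]; rfl
  have hsq : ¬ IsSquare (2 * p * q : ℤ) := by
    rw [mul_assoc]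
    exact Int.not_isSquare_mul_of_prime Int.prime_two (by omega)
  have hmod : (2 * p * q : ℤ) % 4 = 2 := by
    rw [mul_assoc]; omega
  obtain ⟨a, b, u, v, ha, hb, hab, h, hb1⟩ := Pell.exists_mul_eq_sub_eq_one
    (d := 2 * p * q) (by have := hp.pos; have := hq.pos; positivity) hsq
    (fun x y => Pell.odd_even_of_mod_four (by omega))
  have h2p := legendreSym_two_of_mod_eight_eq_five (p := p) hmp
  have h2q := legendreSym_two_of_mod_eight_eq_five (p := q) hmq
  have hrec : legendreSym q p = legendreSym p q :=
    legendreSym.quadratic_reciprocity_one_mod_four (by omega) (by omega)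
  suffices ha1 : a = 1 by
    subst ha1
    rw [one_mul] at hab
    subst hab
    exact ⟨u, v, by linarith⟩
  have hone : ∀ {m n : ℤ}, 0 < m → m * n = 1 → m = 1 ∧ n = 1 := by
    intro m n hm hmn
    have h1 : m = 1 := Int.eq_one_of_mul_eq_one_right hm.le hmn
    exact ⟨h1, by simpa [h1] using hmn⟩
  rw [mul_assoc] at hab
  rcases Int.prime_two.eq_mul_or_eq_mul_of_mul_eq hab with ⟨a, rfl, hab₁⟩ | ⟨b, rfl, hab₁⟩ <;>
    rcases hpi.eq_mul_or_eq_mul_of_mul_eq hab₁ with ⟨a, rfl, hab₂⟩ | ⟨b, rfl, hab₂⟩ <;>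
    rw [← mul_one (q : ℤ)] at hab₂ <;>
    rcases hqi.eq_mul_or_eq_mul_of_mul_eq hab₂ with ⟨a, rfl, hab₃⟩ | ⟨b, rfl, hab₃⟩ <;>
    obtain ⟨rfl, rfl⟩ := hone (by by_contra hcon; nlinarith) hab₃
  · omega
  · have h1 := legendreSym_eq_one_of_mul_sq (p := p) (b := q) (v := v) (k := 2 * u ^ 2)
      (by linarith)
    have h2 := legendreSym_of_neg_mul_sq (p := q) hmq (a := 2 * p) (u := u) (k := v ^ 2)
      (by linarith)
    rw [legendreSym.mul, hrec, h1, h2q] at h2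
    omega
  · have h1 := legendreSym_eq_one_of_mul_sq (p := q) (b := p) (v := v) (k := 2 * u ^ 2)
      (by linarith)
    have h2 := legendreSym_of_neg_mul_sq (p := p) hmp (a := 2 * q) (u := u) (k := v ^ 2)
      (by linarith)
    rw [legendreSym.mul, ← hrec, h1, h2p] at h2
    omega
  · have h2 := legendreSym_of_neg_mul_sq (p := p) hmp (a := 2) (u := u) (k := q * v ^ 2)
      (by linarith)
    omega
  · have h1 := legendreSym_eq_one_of_mul_sq (p := p) (b := 2) (v := v) (k := q * u ^ 2)
      (by linarith)
    omega
  · have h1 := legendreSym_eq_one_of_mul_sq (p := p) (b := 2 * q) (v := v) (k := u ^ 2)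
      (by linarith)
    have h2 := legendreSym_of_neg_mul_sq (p := q) hmq (a := p) (u := u) (k := 2 * v ^ 2)
      (by linarith)
    rw [legendreSym.mul, ← hrec, h2, h2p] at h1
    omega
  · have h1 := legendreSym_eq_one_of_mul_sq (p := q) (b := 2 * p) (v := v) (k := u ^ 2)
      (by linarith)
    have h2 := legendreSym_of_neg_mul_sq (p := p) hmp (a := q) (u := u) (k := 2 * v ^ 2)
      (by linarith)
    rw [legendreSym.mul, hrec, h2, h2q] at h1
    omega
  · rfl

namespace GaussianInt

theorem ext_iff' {z w : GaussianInt} : z = w ↔ z.re = w.re ∧ z.im = w.im := Zsqrtd.ext_iff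

/-- The imaginary unit as a Gaussian integer. -/
def imag : GaussianInt := ⟨0, 1⟩

theorem imag_mul_imag : imag * imag = -1 := by decide

theorem isUnit_imag : IsUnit imag := IsUnit.of_mul_eq_one (-imag) (by decide)

theorem exists_eq_imag_pow {u : GaussianInt} (hu : IsUnit u) : ∃ k : ℕ, u = imag ^ k := by
  have h1 : u.norm = 1 := (Zsqrtd.norm_eq_one_iff' (by norm_num) u).mpr hu
  rw [Zsqrtd.norm_def] at h1
  obtain ⟨x, y⟩ := u
  dsimp only at h1
  have hx1 : x ≤ 1 := by nlinarith [mul_self_nonneg y]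
  have hx2 : -1 ≤ x := by nlinarith [mul_self_nonneg y]
  have hy1 : y ≤ 1 := by nlinarith [mul_self_nonneg x]
  have hy2 : -1 ≤ y := by nlinarith [mul_self_nonneg x]
  interval_cases x <;> interval_cases y <;> simp at h1
  · exact ⟨2, by decide⟩
  · exact ⟨3, by decide⟩
  · exact ⟨1, by decide⟩
  · exact ⟨0, by decide⟩

/-- A degree one prime of `ℤ[i]` above the odd prime `p`, given by a generator and the
reduction map onto `ZMod p` whose kernel it generates. -/
structure SplitPrime (p : ℕ) where
  /-- the generator -/
  gen : GaussianInt
  /-- the reduction map -/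
  red : GaussianInt →+* ZMod p
  gen_mul_star : gen * star gen = p
  red_eq_zero_iff : ∀ z, red z = 0 ↔ gen ∣ z
  red_star_gen_ne_zero : red (star gen) ≠ 0

namespace SplitPrime

theorem nonempty {p : ℕ} (hp : p.Prime) (hm : p % 4 = 1) : Nonempty (SplitPrime p) := by
  have := Fact.mk hp
  obtain ⟨a, b, hab⟩ := Nat.Prime.sq_add_sq (p := p) (by omega)
  have habz : (a : ZMod p) ^ 2 + (b : ZMod p) ^ 2 = 0 := by
    have := congrArg (Nat.cast : ℕ → ZMod p) hab
    push_cast at this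
    simpa using this
  have hb : (b : ZMod p) ≠ 0 := by
    intro hb
    have ha : (a : ZMod p) = 0 := by simpa [hb] using habz
    rw [ZMod.natCast_eq_zero_iff] at ha hb
    have h2 : p * p ∣ p := by
      nth_rewrite 3 [← hab]
      rw [sq, sq]
      exact dvd_add (mul_dvd_mul ha ha) (mul_dvd_mul hb hb)
    have := Nat.le_of_dvd hp.pos h2
    nlinarith [hp.one_lt]
  have ha : (a : ZMod p) ≠ 0 := by
    intro ha
    simp [ha] at habz
    exact hb habz
  have h2 : (2 : ZMod p) ≠ 0 := by
    intro h2
    have : ((2 : ℕ) : ZMod p) = 0 := by exact_mod_cast h2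
    rw [ZMod.natCast_eq_zero_iff] at this
    have := Nat.le_of_dvd (by norm_num) this
    have := hp.two_le
    omega
  let t : ZMod p := -a / b
  have hbt : (b : ZMod p) * t = -a := by simp only [t]; field_simp
  have ht : t * t = ((-1 : ℤ) : ZMod p) := by
    have : (b : ZMod p) ^ 2 * (t * t) = (b : ZMod p) ^ 2 * ((-1 : ℤ) : ZMod p) := by
      push_cast
      linear_combination (b * t - a) * hbt + habz
    exact mul_left_cancel₀ (pow_ne_zero 2 hb) this
  let ψ : GaussianInt →+* ZMod p := Zsqrtd.lift ⟨t, ht⟩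
  have hψ : ∀ z : GaussianInt, ψ z = z.re + z.im * t := fun z => rfl
  let π : GaussianInt := ⟨a, b⟩
  have hπ : π * star π = p := by
    rw [ext_iff']
    constructor
    · simp [π]; rw [← hab]; push_cast; ring
    · simp [π]; ring
  have hψπ : ψ π = 0 := by rw [hψ]; simp [π, hbt]
  have hp0 : (p : GaussianInt) ≠ 0 := by exact_mod_cast hp.ne_zero
  refine ⟨⟨π, ψ, hπ, fun z => ⟨fun hz => ?_, ?_⟩, ?_⟩⟩
  · rw [hψ] at hz
    have h1 : ((z.im * a - z.re * b : ℤ) : ZMod p) = 0 := by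
      push_cast
      linear_combination (-(b : ZMod p)) * hz + z.im * hbt
    have h3 : ((z.re * a + z.im * b : ℤ) : ZMod p) = 0 := by
      have : (b : ZMod p) * ((z.re * a + z.im * b : ℤ) : ZMod p) = 0 := by
        push_cast at h1 ⊢
        linear_combination (-(a : ZMod p)) * h1 + z.im * habz
      exact (mul_eq_zero.mp this).resolve_left hb
    rw [ZMod.intCast_zmod_eq_zero_iff_dvd] at h1 h3
    obtain ⟨m, hm⟩ := h1
    obtain ⟨n, hn⟩ := h3
    have hs : star π ≠ 0 := by
      intro h0
      rw [h0, mul_zero] at hπ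
      exact hp0 hπ.symm
    refine ⟨⟨n, m⟩, mul_left_cancel₀ hs ?_⟩
    rw [← mul_assoc, mul_comm (star π) π, hπ, ext_iff']
    constructor
    · simp [π]; linarith
    · simp [π]; linarith
  · rintro ⟨w, rfl⟩
    rw [map_mul, hψπ, zero_mul]
  · rw [hψ]
    simp only [π, Zsqrtd.re_star, Zsqrtd.im_star]
    push_cast
    intro h0
    have : (2 : ZMod p) * a = 0 := by linear_combination h0 + hbt
    exact (mul_ne_zero h2 ha) this

variable {p : ℕ} (P : SplitPrime p)

/-- The conjugate prime. -/
def conj : SplitPrime p where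
  gen := star P.gen
  red := P.red.comp (starRingEnd GaussianInt)
  gen_mul_star := by rw [star_star, mul_comm, P.gen_mul_star]
  red_eq_zero_iff z := by
    rw [RingHom.comp_apply, P.red_eq_zero_iff, starRingEnd_apply]
    constructor
    · rintro ⟨w, hw⟩
      exact ⟨star w, by rw [← star_mul', ← hw, star_star]⟩
    · rintro ⟨w, rfl⟩
      exact ⟨star w, by rw [star_mul', star_star]⟩
  red_star_gen_ne_zero := by
    rw [RingHom.comp_apply, star_star, starRingEnd_apply]
    exact P.red_star_gen_ne_zero

theorem gen_conj : P.conj.gen = star P.gen := rfl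

theorem red_gen : P.red P.gen = 0 := (P.red_eq_zero_iff _).mpr dvd_rfl

variable [Fact p.Prime]

theorem gen_ne_zero : P.gen ≠ 0 := by
  intro h
  have := P.gen_mul_star
  rw [h, zero_mul] at this
  exact (Fact.out : p.Prime).ne_zero (by exact_mod_cast this.symm)

theorem prime_gen : Prime P.gen := by
  refine ⟨P.gen_ne_zero, fun hu => ?_, fun a b hab => ?_⟩
  · have h1 := (P.red_eq_zero_iff 1).mpr hu.dvd
    rw [map_one] at h1
    exact one_ne_zero h1
  · rw [← P.red_eq_zero_iff] at hab ⊢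
    rw [← P.red_eq_zero_iff]
    rwa [map_mul, mul_eq_zero] at hab

/-- The quadratic residue symbol modulo `P`. -/
def symb (z : GaussianInt) : ℤ := quadraticChar (ZMod p) (P.red z)

theorem symb_mul (z w : GaussianInt) : P.symb (z * w) = P.symb z * P.symb w := by
  rw [symb, symb, symb, map_mul, map_mul]

theorem symb_pow (z : GaussianInt) (n : ℕ) : P.symb (z ^ n) = P.symb z ^ n := by
  rw [symb, symb, map_pow, map_pow]

theorem symb_intCast (n : ℤ) : P.symb n = legendreSym p n := by
  simp [symb, legendreSym]

theorem symb_natCast (n : ℕ) : P.symb n = legendreSym p n := by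
  simp [symb, legendreSym]

theorem symb_two (hm : p % 8 = 5) : P.symb 2 = -1 := by
  have h := P.symb_intCast 2
  rw [legendreSym_two_of_mod_eight_eq_five hm] at h
  exact_mod_cast h

theorem symb_conj (z : GaussianInt) : P.conj.symb z = P.symb (star z) := rfl

theorem symb_neg_one (hm : p % 8 = 5) : P.symb (-1) = 1 := by
  have h := P.symb_intCast (-1)
  rw [legendreSym_neg_one_of_mod_eight_eq_five hm] at h
  exact_mod_cast h

theorem symb_eq_one_or_neg_one {z : GaussianInt} (hz : P.red z ≠ 0) :
    P.symb z = 1 ∨ P.symb z = -1 := quadraticChar_dichotomy hz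

/-- `i` is not a square modulo `P` since `p ≡ 5` modulo `8`: indeed `2 i = (1 + i) ^ 2`. -/
theorem symb_imag (hm : p % 8 = 5) : P.symb imag = -1 := by
  have h2 : P.symb (2 * imag) = P.symb (1 + imag) ^ 2 := by
    rw [← symb_pow]; congr 1
  rw [symb_mul, P.symb_two hm] at h2
  have hi : P.red imag ≠ 0 := by
    intro h
    have := congrArg P.red imag_mul_imag
    simp [h] at this
  rcases P.symb_eq_one_or_neg_one hi with h | h
  · rw [h] at h2; nlinarith [sq_nonneg (P.symb (1 + imag))]
  · exact h

/-- Local condition at `P` for `s` to be represented by `X² - d Y²` up to squares. -/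
theorem symb_eq_one_of_eq {d' s : GaussianInt} (hd : P.red d' ≠ 0) (hs : P.red s ≠ 0) :
    ∀ {X Y C : GaussianInt}, C ≠ 0 → X ^ 2 - P.gen * d' * Y ^ 2 = s * C ^ 2 → P.symb s = 1 := by
  intro X Y C hC h
  induction hn : C.norm.natAbs using Nat.strong_induction_on generalizing X Y C with
  | _ n ih =>
  subst hn
  have h1 : P.red X ^ 2 = P.red s * P.red C ^ 2 := by
    have := congrArg P.red h
    simpa [P.red_gen] using this
  by_cases hC0 : P.red C = 0
  · rw [hC0] at h1
    have hX0 : P.red X = 0 := by simpa using h1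
    obtain ⟨C, rfl⟩ := (P.red_eq_zero_iff _).mp hC0
    obtain ⟨X, rfl⟩ := (P.red_eq_zero_iff _).mp hX0
    have h2 : P.gen * X ^ 2 - d' * Y ^ 2 = P.gen * (s * C ^ 2) :=
      mul_left_cancel₀ P.gen_ne_zero (by linear_combination h)
    have hY0 : P.red Y = 0 := by
      have := congrArg P.red h2
      simpa [P.red_gen, hd] using this
    obtain ⟨Y, rfl⟩ := (P.red_eq_zero_iff _).mp hY0
    have hC' : C ≠ 0 := right_ne_zero_of_mul hC
    refine ih _ ?_ (X := X) (Y := Y) (C := C) hC'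
      (mul_left_cancel₀ P.gen_ne_zero (by linear_combination h2)) rfl
    have hgn : 1 < P.gen.norm := by
      have h0 := GaussianInt.norm_pos.mpr P.gen_ne_zero
      have : P.gen.norm ≠ 1 := fun h1 =>
        P.prime_gen.not_isUnit ((Zsqrtd.norm_eq_one_iff' (by norm_num) _).mp h1)
      omega
    have hCn := GaussianInt.norm_pos.mpr hC'
    rw [Zsqrtd.norm_mul, Int.natAbs_mul]
    have : 1 < P.gen.norm.natAbs := by omega
    have : 0 < C.norm.natAbs := by omega
    nlinarith
  · have h2 : P.symb (X ^ 2) = P.symb s * P.symb C ^ 2 := by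
      rw [← symb_pow, ← symb_mul, symb, symb]; simp [h1]
    have hX0 : P.red X ≠ 0 := by
      intro h0
      rw [h0] at h1
      exact mul_ne_zero hs (pow_ne_zero 2 hC0) (by simpa using h1.symm)
    have e1 : P.symb X ^ 2 = 1 := quadraticChar_sq_one hX0
    have e2 : P.symb C ^ 2 = 1 := quadraticChar_sq_one hC0
    rw [symb_pow, e1, e2] at h2
    linarith

end SplitPrime

end GaussianInt

namespace GaussianInt

/-- Up to nonzero squares, `s` is of the form `X² - d Y²`. -/
def IsNormForm (d s : GaussianInt) : Prop :=
  ∃ X Y C : GaussianInt, C ≠ 0 ∧ X ^ 2 - d * Y ^ 2 = s * C ^ 2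

namespace IsNormForm

variable {d s t : GaussianInt}

theorem mul (hs : IsNormForm d s) (ht : IsNormForm d t) : IsNormForm d (s * t) := by
  obtain ⟨X, Y, C, hC, h⟩ := hs
  obtain ⟨X', Y', C', hC', h'⟩ := ht
  refine ⟨X * X' + d * (Y * Y'), X * Y' + Y * X', C * C', mul_ne_zero hC hC', ?_⟩
  linear_combination (X' ^ 2 - d * Y' ^ 2) * h + s * C ^ 2 * h'

theorem neg_self : IsNormForm d (-d) := ⟨0, 1, 1, one_ne_zero, by ring⟩

theorem of_mul_sq (ht : t ≠ 0) (h : IsNormForm d (s * t ^ 2)) : IsNormForm d s := by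
  obtain ⟨X, Y, C, hC, h⟩ := h
  exact ⟨X, Y, t * C, mul_ne_zero ht hC, by linear_combination h⟩

end IsNormForm

namespace SplitPrime

variable {p : ℕ} [Fact p.Prime] (P : SplitPrime p)

theorem symb_eq_one_of_isNormForm {d' s : GaussianInt} (hd : P.red d' ≠ 0) (hs : P.red s ≠ 0)
    (h : IsNormForm (P.gen * d') s) : P.symb s = 1 := by
  obtain ⟨X, Y, C, hC, h⟩ := h
  exact P.symb_eq_one_of_eq hd hs hC h

theorem symb_eq_one_of_isNormForm_gen_mul {d' s : GaussianInt} (hd : P.red d' ≠ 0)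
    (hs : P.red s ≠ 0) (h : IsNormForm (P.gen * d') (P.gen * s)) : P.symb (-1 * d' * s) = 1 := by
  have h1 := IsNormForm.neg_self.mul h
  rw [show -(P.gen * d') * (P.gen * s) = (-1 * d' * s) * P.gen ^ 2 by ring] at h1
  exact P.symb_eq_one_of_isNormForm hd (by simp [hs, hd]) (h1.of_mul_sq P.gen_ne_zero)

variable {q : ℕ} [Fact q.Prime] (Q : SplitPrime q)

theorem red_natCast_ne_zero (hne : p ≠ q) : P.red (q : GaussianInt) ≠ 0 := by
  rw [map_natCast, Ne, ZMod.natCast_eq_zero_iff]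
  exact fun h => hne ((Nat.prime_dvd_prime_iff_eq Fact.out Fact.out).mp h)

theorem red_gen_mul_star_ne_zero (hne : p ≠ q) : P.red Q.gen * P.red (star Q.gen) ≠ 0 := by
  rw [← map_mul, Q.gen_mul_star]
  exact P.red_natCast_ne_zero hne

theorem red_imag_ne_zero : P.red imag ≠ 0 := by
  intro h
  have := congrArg P.red imag_mul_imag
  simp [h] at this

theorem red_two_ne_zero (hmp : p % 8 = 5) : P.red 2 ≠ 0 := by
  intro h
  have := P.symb_two hmp
  rw [symb, h] at this
  simp at this

/-- The condition at `P` for a product of primes above `p` and `q` to be a norm form for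
`d = 2 * p * q`. -/
theorem symb_relation (hmp : p % 8 = 5) (hne : p ≠ q) {k e f e' f' : ℕ} (he : e ≤ 1)
    (h : IsNormForm (2 * p * q)
      (imag ^ k * P.gen ^ e * star P.gen ^ f * Q.gen ^ e' * star Q.gen ^ f')) :
    (-1) ^ k * (-P.symb q * P.symb (star P.gen)) ^ e * P.symb (star P.gen) ^ f *
      P.symb Q.gen ^ e' * P.symb (star Q.gen) ^ f' = 1 := by
  have hQ := P.red_gen_mul_star_ne_zero Q hne
  have h2 := P.red_two_ne_zero hmp
  have hq := P.red_natCast_ne_zero hne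
  have hi := P.red_imag_ne_zero
  have hd : P.red (2 * star P.gen * q) ≠ 0 := by
    rw [map_mul, map_mul]
    exact mul_ne_zero (mul_ne_zero h2 P.red_star_gen_ne_zero) hq
  have hs : P.red (imag ^ k * star P.gen ^ f * Q.gen ^ e' * star Q.gen ^ f') ≠ 0 := by
    simp only [map_mul, map_pow]
    exact mul_ne_zero (mul_ne_zero (mul_ne_zero (pow_ne_zero _ hi)
      (pow_ne_zero _ P.red_star_gen_ne_zero)) (pow_ne_zero _ (left_ne_zero_of_mul hQ)))
      (pow_ne_zero _ (right_ne_zero_of_mul hQ))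
  rw [show (2 * p * q : GaussianInt) = P.gen * (2 * star P.gen * q) by
    rw [← P.gen_mul_star]; ring] at h
  interval_cases e
  · have := P.symb_eq_one_of_isNormForm hd hs (by simpa using h)
    simp only [symb_mul, symb_pow, P.symb_imag hmp] at this
    simpa using this
  · have := P.symb_eq_one_of_isNormForm_gen_mul hd hs (by convert h using 1; ring)
    simp only [symb_mul, symb_pow, P.symb_imag hmp, P.symb_neg_one hmp, P.symb_two hmp] at this
    linear_combination this

theorem exponents_eq (hmp : p % 8 = 5) (hmq : q % 8 = 5) (hne : p ≠ q) {k e f e' f' : ℕ}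
    (he : e ≤ 1) (hf : f ≤ 1) (he' : e' ≤ 1) (hf' : f' ≤ 1)
    (h : IsNormForm (2 * p * q)
      (imag ^ k * P.gen ^ e * star P.gen ^ f * Q.gen ^ e' * star Q.gen ^ f')) :
    e = f ∧ e = e' ∧ e = f' := by
  have hrec : Q.symb p = P.symb q := by
    rw [symb_natCast, symb_natCast]
    exact legendreSym.quadratic_reciprocity_one_mod_four (by omega) (by omega)
  have hP := P.red_gen_mul_star_ne_zero Q hne
  have hQ := Q.red_gen_mul_star_ne_zero P hne.symm
  have r1 := P.symb_relation Q hmp hne he h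
  have r2 := P.conj.symb_relation Q (k := k) (f := e) (e' := e') (f' := f') hmp hne hf
    (by rw [gen_conj, star_star]; convert h using 1; ring)
  have r3 := Q.symb_relation P (k := k) (f := f') (e' := e) (f' := f) hmq hne.symm he'
    (by convert h using 1 <;> ring)
  have r4 := Q.conj.symb_relation P (k := k) (f := e') (e' := e) (f' := f) hmq hne.symm hf'
    (by rw [gen_conj, star_star]; convert h using 1 <;> ring)
  simp only [symb_conj, gen_conj, star_star, star_natCast] at r1 r2 r3 r4
  have m1 : P.symb Q.gen * P.symb (star Q.gen) = P.symb q := by rw [← symb_mul, Q.gen_mul_star]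
  have m2 : Q.symb P.gen * Q.symb (star P.gen) = P.symb q := by
    rw [← symb_mul, P.gen_mul_star, hrec]
  rw [hrec] at r3 r4
  rw [← m1] at r1 r2 m2 r3 r4
  have hk : ((-1 : ℤ) ^ k) = 1 ∨ (-1 : ℤ) ^ k = -1 := neg_one_pow_eq_or ℤ k
  have s1 := P.symb_eq_one_or_neg_one (left_ne_zero_of_mul hP)
  have s2 := P.symb_eq_one_or_neg_one (right_ne_zero_of_mul hP)
  have s3 := Q.symb_eq_one_or_neg_one (left_ne_zero_of_mul hQ)
  have s4 := Q.symb_eq_one_or_neg_one (right_ne_zero_of_mul hQ)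
  have s5 := P.symb_eq_one_or_neg_one P.red_star_gen_ne_zero
  have s6 := Q.symb_eq_one_or_neg_one Q.red_star_gen_ne_zero
  generalize P.symb Q.gen = x1 at *
  generalize P.symb (star Q.gen) = x2 at *
  generalize Q.symb P.gen = x3 at *
  generalize Q.symb (star P.gen) = x4 at *
  generalize P.symb (star P.gen) = x5 at *
  generalize Q.symb (star Q.gen) = x6 at *
  generalize (-1 : ℤ) ^ k = x7 at *
  clear h hrec hP hQ m1
  interval_cases e <;> interval_cases f <;> interval_cases e' <;> interval_cases f' <;>
    first
    | exact ⟨rfl, rfl, rfl⟩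
    | (exfalso
       rcases s1 with rfl | rfl <;> rcases s2 with rfl | rfl <;> rcases s5 with rfl | rfl <;>
        rcases hk with rfl | rfl <;> rcases s3 with rfl | rfl <;> rcases s4 with rfl | rfl <;>
        rcases s6 with rfl | rfl <;> revert r1 r2 r3 r4 m2 <;> decide)

end SplitPrime

end GaussianInt

theorem exists_eq_squarefree_mul_sq {R : Type*} [CommRing R] [IsDomain R] [WfDvdMonoid R]
    {n : R} (hn : n ≠ 0) : ∃ r c : R, Squarefree r ∧ n = r * c ^ 2 := by
  induction n using (IsWellFounded.wf (r := DvdNotUnit (α := R))).induction with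
  | _ n ih =>
  by_cases hsq : Squarefree n
  · exact ⟨n, 1, hsq, by ring⟩
  · simp only [Squarefree, not_forall] at hsq
    obtain ⟨x, ⟨m, rfl⟩, hx⟩ := hsq
    have hm : m ≠ 0 := right_ne_zero_of_mul hn
    obtain ⟨r, c, hr, rfl⟩ := ih m
      ⟨hm, x * x, fun h => hx (isUnit_of_mul_isUnit_left h), by ring⟩ hm
    exact ⟨r, c * x, hr, by ring⟩

namespace GaussianInt

theorem irreducible_of_norm_prime {z : GaussianInt} (h : z.norm.natAbs.Prime) :
    Irreducible z := by
  refine ⟨fun hu => ?_, fun {a b} hab => ?_⟩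
  · rw [← Zsqrtd.norm_eq_one_iff] at hu
    exact h.one_lt.ne' hu
  · rw [hab, Zsqrtd.norm_mul, Int.natAbs_mul] at h
    rw [← Zsqrtd.norm_eq_one_iff, ← Zsqrtd.norm_eq_one_iff]
    rcases Nat.prime_mul_iff.mp h with h | h
    · exact Or.inr h.2
    · exact Or.inl h.2

/-- The prime `1 + i` above `2`. -/
def lam : GaussianInt := ⟨1, 1⟩

theorem lam_sq : lam ^ 2 = 2 * imag := by decide

theorem lam_eq : lam = 1 + imag := by decide

theorem lam_ne_zero : lam ≠ 0 := by decide

theorem prime_lam : Prime lam :=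
  (irreducible_of_norm_prime (by
    rw [show lam.norm.natAbs = 2 by decide]; exact Nat.prime_two)).prime

namespace SplitPrime

variable {p q : ℕ} (P : SplitPrime p) (Q : SplitPrime q)

/-- The monomials in `i`, `1 + i` and the primes above `p` and `q`. -/
def monomial (k e₀ e f e' f' : ℕ) : GaussianInt :=
  imag ^ k * lam ^ e₀ * P.gen ^ e * star P.gen ^ f * Q.gen ^ e' * star Q.gen ^ f'

/-- If `x² + 1` is twice an odd number and `x + i` is a monomial times a square, then `1 + i`
occurs to an odd power. -/
theorem odd_of_monomial_mul_sq_eq (hp : p % 2 = 1) (hq : q % 2 = 1) {x : ℤ} (hx : Odd x)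
    {k e₀ e f e' f' : ℕ} {c : GaussianInt}
    (h : x + imag = monomial P Q k e₀ e f e' f' * c ^ 2) : Odd e₀ := by
  by_contra hcon
  rw [Nat.not_odd_iff_even] at hcon
  obtain ⟨m, rfl⟩ := hcon
  have hP : P.gen.norm = p := by
    have := P.gen_mul_star
    rw [← Zsqrtd.norm_eq_mul_conj] at this
    exact_mod_cast this
  have hQ : Q.gen.norm = q := by
    have := Q.gen_mul_star
    rw [← Zsqrtd.norm_eq_mul_conj] at this
    exact_mod_cast this
  have hnpow : ∀ (z : GaussianInt) (n : ℕ), (z ^ n).norm = z.norm ^ n := fun z n =>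
    map_pow Zsqrtd.normMonoidHom z n
  have h1 := congrArg Zsqrtd.norm h
  simp only [monomial, Zsqrtd.norm_mul, hnpow, Zsqrtd.norm_conj, hP, hQ] at h1
  rw [show imag.norm = 1 by decide, show lam.norm = 2 by decide, one_pow, one_mul,
    show (x + imag : GaussianInt).norm = x ^ 2 + 1 by
      simp [Zsqrtd.norm_def, imag]; ring] at h1
  have hpo : Odd ((p : ℤ) ^ e * p ^ f * q ^ e' * q ^ f') := by
    have h1 : Odd (p : ℤ) := by rw [Int.odd_iff]; omega
    have h2 : Odd (q : ℤ) := by rw [Int.odd_iff]; omega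
    exact ((h1.pow.mul h1.pow).mul h2.pow).mul h2.pow
  have h2 : x ^ 2 + 1 = ((p : ℤ) ^ e * p ^ f * q ^ e' * q ^ f') * (2 ^ m * c.norm) ^ 2 := by
    rw [h1]; ring
  generalize (p : ℤ) ^ e * p ^ f * q ^ e' * q ^ f' = A at hpo h2
  generalize 2 ^ m * c.norm = B at h2
  have hx4 : x ^ 2 % 4 = 1 := Int.sq_mod_four_eq_one_of_odd hx
  rcases Int.even_or_odd B with ⟨B, rfl⟩ | hB
  · have : x ^ 2 + 1 = 4 * (A * B ^ 2) := by rw [h2]; ring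
    omega
  · have := hpo.mul (hB.pow (n := 2))
    rw [← h2, Int.odd_iff] at this
    omega

variable [Fact p.Prime] [Fact q.Prime]

theorem exists_eq_monomial {r : GaussianInt} (hr0 : r ≠ 0)
    (hr : ∀ z, Prime z → z ∣ r → z ∣ 2 * p * q) :
    ∃ k e₀ e f e' f', r = monomial P Q k e₀ e f e' f' := by
  induction r using UniqueFactorizationMonoid.induction_on_prime with
  | h₁ => exact absurd rfl hr0
  | h₂ u hu =>
    obtain ⟨k, rfl⟩ := exists_eq_imag_pow hu
    exact ⟨k, 0, 0, 0, 0, 0, by simp [monomial]⟩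
  | h₃ a z ha hz ih =>
    obtain ⟨k, e₀, e, f, e', f', rfl⟩ := ih ha fun w hw hwa => hr w hw (hwa.mul_left _)
    have key : ∀ {w : GaussianInt}, Prime w → z ∣ w → ∃ j, z = imag ^ j * w := by
      intro w hw hzw
      obtain ⟨u, hu⟩ := hz.associated_of_dvd hw hzw
      obtain ⟨j, hj⟩ := exists_eq_imag_pow (u⁻¹).isUnit
      refine ⟨j, ?_⟩
      rw [← hu, ← hj, mul_comm z, ← mul_assoc, Units.inv_mul, one_mul]
    have hd := hr z hz (dvd_mul_right _ _)
    rw [← P.gen_mul_star, ← Q.gen_mul_star] at hd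
    have h2 : z ∣ 2 → z ∣ lam := fun h => hz.dvd_of_dvd_pow (n := 2)
      (by rw [lam_sq]; exact h.mul_right _)
    have hP' := P.conj.prime_gen
    have hQ' := Q.conj.prime_gen
    rcases hz.dvd_or_dvd hd with hd | hd
    · rcases hz.dvd_or_dvd hd with hd | hd
      · obtain ⟨j, rfl⟩ := key prime_lam (h2 hd)
        exact ⟨k + j, e₀ + 1, e, f, e', f', by simp only [monomial]; ring⟩
      · rcases hz.dvd_or_dvd hd with hd | hd
        · obtain ⟨j, rfl⟩ := key P.prime_gen hd
          exact ⟨k + j, e₀, e + 1, f, e', f', by simp only [monomial]; ring⟩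
        · obtain ⟨j, rfl⟩ := key hP' hd
          exact ⟨k + j, e₀, e, f + 1, e', f', by simp only [monomial, gen_conj]; ring⟩
    · rcases hz.dvd_or_dvd hd with hd | hd
      · obtain ⟨j, rfl⟩ := key Q.prime_gen hd
        exact ⟨k + j, e₀, e, f, e' + 1, f', by simp only [monomial]; ring⟩
      · obtain ⟨j, rfl⟩ := key hQ' hd
        exact ⟨k + j, e₀, e, f, e', f' + 1, by simp only [monomial, gen_conj]; ring⟩

theorem monomial_eq_mul_sq (k e₀ e f e' f' : ℕ) : ∃ c, c ≠ 0 ∧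
    monomial P Q k e₀ e f e' f' =
      monomial P Q k (e₀ % 2) (e % 2) (f % 2) (e' % 2) (f' % 2) * c ^ 2 := by
  have h : ∀ (z : GaussianInt) (n : ℕ), z ^ n = z ^ (n % 2) * (z ^ (n / 2)) ^ 2 := by
    intro z n
    rw [← pow_mul, ← pow_add, mul_comm, Nat.mod_add_div]
  refine ⟨lam ^ (e₀ / 2) * P.gen ^ (e / 2) * star P.gen ^ (f / 2) * Q.gen ^ (e' / 2) *
    star Q.gen ^ (f' / 2), ?_, ?_⟩
  · have h1 := P.conj.gen_ne_zero
    have h2 := Q.conj.gen_ne_zero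
    rw [gen_conj] at h1 h2
    have h3 := P.gen_ne_zero
    have h4 := Q.gen_ne_zero
    have h5 := lam_ne_zero
    positivity
  · simp only [monomial]
    rw [h lam e₀, h P.gen e, h (star P.gen) f, h Q.gen e', h (star Q.gen) f']
    ring

/-- An even monomial which is a norm form is `1` or `p * q` up to units and squares. -/
theorem eq_of_isNormForm_of_even (hmp : p % 8 = 5) (hmq : q % 8 = 5) (hne : p ≠ q)
    {k e₀ e f e' f' : ℕ} {c : GaussianInt} (hc : c ≠ 0) (he₀ : Even e₀)
    (h : IsNormForm (2 * p * q) (monomial P Q k e₀ e f e' f' * c ^ 2)) :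
    ∃ b, b ≠ 0 ∧ (monomial P Q k e₀ e f e' f' * c ^ 2 = imag ^ k * b ^ 2 ∨
      monomial P Q k e₀ e f e' f' * c ^ 2 = imag ^ k * (p * q) * b ^ 2) := by
  obtain ⟨a, ha, hm⟩ := monomial_eq_mul_sq P Q k e₀ e f e' f'
  rw [hm] at h ⊢
  have h' := (h.of_mul_sq hc).of_mul_sq ha
  rw [Nat.even_iff.mp he₀] at h' ⊢
  simp only [monomial, pow_zero, mul_one] at h' ⊢
  have hlt : ∀ n, n % 2 ≤ 1 := fun n => by omega
  obtain ⟨h1, h2, h3⟩ := P.exponents_eq Q hmp hmq hne (hlt e) (hlt f) (hlt e') (hlt f') h'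
  rw [← h1, ← h2, ← h3]
  refine ⟨a * c, mul_ne_zero ha hc, ?_⟩
  rcases Nat.mod_two_eq_zero_or_one e with h0 | h0
  · left; rw [h0]; ring
  · right; rw [h0, ← P.gen_mul_star, ← Q.gen_mul_star]; ring

theorem eq_of_isNormForm (hmp : p % 8 = 5) (hmq : q % 8 = 5) (hne : p ≠ q)
    {k e₀ e f e' f' k₁ g₀ g h g' h' : ℕ} {c c₁ : GaussianInt} (hc : c ≠ 0) (hc₁ : c₁ ≠ 0)
    (hg₀ : Odd g₀)
    (hn : IsNormForm (2 * p * q) (monomial P Q k e₀ e f e' f' * c ^ 2))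
    (hm : IsNormForm (2 * p * q) (monomial P Q k₁ g₀ g h g' h' * c₁ ^ 2)) :
    ∃ j b, b ≠ 0 ∧ (monomial P Q k e₀ e f e' f' * c ^ 2 = imag ^ j * b ^ 2 ∨
      monomial P Q k e₀ e f e' f' * c ^ 2 = imag ^ j * (p * q) * b ^ 2 ∨
      monomial P Q k e₀ e f e' f' * c ^ 2 * (monomial P Q k₁ g₀ g h g' h' * c₁ ^ 2) =
        imag ^ j * b ^ 2 ∨
      monomial P Q k e₀ e f e' f' * c ^ 2 * (monomial P Q k₁ g₀ g h g' h' * c₁ ^ 2) =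
        imag ^ j * (p * q) * b ^ 2) := by
  rcases Nat.even_or_odd e₀ with he₀ | he₀
  · obtain ⟨b, hb, h | h⟩ := eq_of_isNormForm_of_even P Q hmp hmq hne hc he₀ hn
    · exact ⟨k, b, hb, Or.inl h⟩
    · exact ⟨k, b, hb, Or.inr (Or.inl h)⟩
  · have hprod : monomial P Q k e₀ e f e' f' * c ^ 2 * (monomial P Q k₁ g₀ g h g' h' * c₁ ^ 2) =
        monomial P Q (k + k₁) (e₀ + g₀) (e + g) (f + h) (e' + g') (f' + h') * (c * c₁) ^ 2 := by
      simp only [monomial]; ring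
    have hnm := hn.mul hm
    rw [hprod] at hnm ⊢
    obtain ⟨b, hb, h | h⟩ := eq_of_isNormForm_of_even P Q hmp hmq hne (mul_ne_zero hc hc₁)
      (he₀.add_odd hg₀) hnm
    · exact ⟨k + k₁, b, hb, Or.inr (Or.inr (Or.inl h))⟩
    · exact ⟨k + k₁, b, hb, Or.inr (Or.inr (Or.inr h))⟩

end SplitPrime

end GaussianInt

theorem IsIntegrallyClosed.dvd_of_dvd_add_of_sq_dvd_mul {R : Type*} [CommRing R] [IsDomain R]
    [IsIntegrallyClosed R] {c u v : R} (hc : c ≠ 0) (h1 : c ∣ u + v) (h2 : c ^ 2 ∣ u * v) :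
    c ∣ u := by
  obtain ⟨t, ht⟩ := h1
  obtain ⟨m, hm⟩ := h2
  have hc' : algebraMap R (FractionRing R) c ≠ 0 := by simpa using hc
  have hint : IsIntegral R (algebraMap R (FractionRing R) u / algebraMap R (FractionRing R) c) := by
    refine ⟨Polynomial.X ^ 2 - Polynomial.C t * Polynomial.X + Polynomial.C m, by monicity!, ?_⟩
    have ht' := congrArg (algebraMap R (FractionRing R)) ht
    have hm' := congrArg (algebraMap R (FractionRing R)) hm
    simp only [map_add, map_mul, map_pow] at ht' hm'
    simp only [Polynomial.eval₂_add, Polynomial.eval₂_sub, Polynomial.eval₂_mul,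
      Polynomial.eval₂_pow, Polynomial.eval₂_X, Polynomial.eval₂_C]
    field_simp
    linear_combination algebraMap R (FractionRing R) u * ht' - hm'
  obtain ⟨w, hw⟩ := IsIntegrallyClosed.isIntegral_iff.mp hint
  refine ⟨w, IsFractionRing.injective R (FractionRing R) ?_⟩
  rw [map_mul, hw]
  field_simp

/-- A unit times a square. -/
def IsUnitMulSq {R : Type*} [CommRing R] (x : R) : Prop :=
  ∃ (w : Rˣ) (κ : R), x = w * κ ^ 2

namespace IsUnitMulSq

variable {R S : Type*} [CommRing R] [CommRing S] {x y : R}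

theorem mul (hx : IsUnitMulSq x) (hy : IsUnitMulSq y) : IsUnitMulSq (x * y) := by
  obtain ⟨w, κ, rfl⟩ := hx
  obtain ⟨w', κ', rfl⟩ := hy
  exact ⟨w * w', κ * κ', by push_cast; ring⟩

theorem of_isUnit (hx : IsUnit x) : IsUnitMulSq x := ⟨hx.unit, 1, by simp⟩

theorem sq (x : R) : IsUnitMulSq (x ^ 2) := ⟨1, x, by simp⟩

theorem pow (hx : IsUnitMulSq x) (n : ℕ) : IsUnitMulSq (x ^ n) := by
  obtain ⟨w, κ, rfl⟩ := hx
  exact ⟨w ^ n, κ ^ n, by push_cast; ring⟩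

variable [IsDomain R] [IsIntegrallyClosed R]

theorem of_mul_sq (hy : y ≠ 0) (h : IsUnitMulSq (x * y ^ 2)) : IsUnitMulSq x := by
  obtain ⟨w, κ, h⟩ := h
  have hd : y ^ 2 ∣ κ ^ 2 := ⟨↑w⁻¹ * x, by
    rw [mul_left_comm, mul_comm (y ^ 2), h, Units.inv_mul_cancel_left]⟩
  obtain ⟨z, rfl⟩ := (IsIntegrallyClosed.pow_dvd_pow_iff two_ne_zero).mp hd
  exact ⟨w, z, mul_right_cancel₀ (pow_ne_zero 2 hy) (by rw [h]; ring)⟩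

theorem of_mul (hy0 : y ≠ 0) (hy : IsUnitMulSq y) (h : IsUnitMulSq (x * y)) :
    IsUnitMulSq x := by
  refine of_mul_sq hy0 ?_
  rw [pow_two, ← mul_assoc]
  exact h.mul hy

end IsUnitMulSq

/-- An involution of a ring `B` with fixed ring `ℤ[i]`, together with a square root of
`d` which is negated by it. -/
structure QuadraticConj (B : Type*) [CommRing B] (d : GaussianInt) where
  /-- the embedding of the fixed ring -/
  emb : GaussianInt →+* B
  emb_injective : Function.Injective emb
  /-- the involution -/
  conj : B ≃+* B
  conj_conj : ∀ z, conj (conj z) = z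
  conj_emb : ∀ a, conj (emb a) = emb a
  exists_emb_eq : ∀ z, conj z = z → ∃ a, emb a = z
  /-- the square root of `d` -/
  root : B
  root_sq : root ^ 2 = emb d
  conj_root : conj root = -root

namespace QuadraticConj

open GaussianInt

variable {B : Type*} [CommRing B] {d : GaussianInt} (E : QuadraticConj B d)

theorem emb_eq_zero_iff {a : GaussianInt} : E.emb a = 0 ↔ a = 0 :=
  map_eq_zero_iff _ E.emb_injective

theorem emb_ne_zero {a : GaussianInt} (ha : a ≠ 0) : E.emb a ≠ 0 :=
  fun h => ha (E.emb_eq_zero_iff.mp h)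

theorem isNormForm (hd : d ≠ 0) {z : B} {n : GaussianInt} (h : E.emb n = z * E.conj z) :
    IsNormForm d n := by
  obtain ⟨T, hT⟩ := E.exists_emb_eq (z + E.conj z) (by rw [map_add, E.conj_conj, add_comm])
  obtain ⟨s, hs⟩ := E.exists_emb_eq ((z - E.conj z) * E.root) (by
    rw [map_mul, map_sub, E.conj_conj, E.conj_root]; ring)
  have h2 : (2 : GaussianInt) ≠ 0 := by decide
  refine ⟨d * T, s, 2 * d, mul_ne_zero h2 hd, E.emb_injective ?_⟩
  simp only [map_sub, map_pow, map_mul, map_ofNat, hT, hs, h]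
  linear_combination (-(E.emb d) * (z - E.conj z) ^ 2) * E.root_sq

theorem map_conj_span (z : B) :
    (Ideal.span {z}).map E.conj = Ideal.span {E.conj z} := by
  rw [Ideal.map_span, Set.image_singleton]

theorem mem_map_conj {I : Ideal B} {z : B} (hz : z ∈ I.map E.conj) : ∃ y ∈ I, z = E.conj y := by
  obtain ⟨y, hy, rfl⟩ := (Ideal.mem_map_iff_of_surjective E.conj E.conj.surjective).mp hz
  exact ⟨y, hy, rfl⟩

variable [IsDomain B]

theorem emb_dvd_emb {a b : GaussianInt} (h : E.emb a ∣ E.emb b) : a ∣ b := by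
  obtain ⟨y, hy⟩ := h
  by_cases ha : a = 0
  · rw [ha, map_zero, zero_mul, E.emb_eq_zero_iff] at hy
    rw [hy]; exact dvd_zero _
  · have h1 := congrArg E.conj hy
    rw [map_mul, E.conj_emb, E.conj_emb, hy] at h1
    obtain ⟨c, rfl⟩ := E.exists_emb_eq y (mul_left_cancel₀ (E.emb_ne_zero ha) h1).symm
    exact ⟨c, E.emb_injective (by rw [hy, map_mul])⟩

/-- A unit of `B` fixed by the involution comes from a unit of `ℤ[i]`. -/
theorem exists_emb_imag_pow_mul_eq {a b : GaussianInt}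
    (h : Associated (E.emb a) (E.emb b)) : ∃ k : ℕ, b = imag ^ k * a := by
  obtain ⟨u, rfl⟩ := associated_of_dvd_dvd (E.emb_dvd_emb h.dvd) (E.emb_dvd_emb h.symm.dvd)
  obtain ⟨k, hk⟩ := exists_eq_imag_pow u.isUnit
  exact ⟨k, by rw [hk, mul_comm]⟩

variable [IsIntegrallyClosed B]

theorem exists_mul_map_conj_eq {I : Ideal B} (hI : I ≠ 0) :
    ∃ n, n ≠ 0 ∧ I * I.map E.conj = Ideal.span {E.emb n} := by
  let S : Set GaussianInt := {a | ∃ α ∈ I, ∃ β ∈ I,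
    E.emb a = α * E.conj β + β * E.conj α ∨ E.emb a = α * E.conj α}
  obtain ⟨n, hn⟩ : ∃ n, Ideal.span S = Ideal.span {n} :=
    (IsPrincipalIdealRing.principal (Ideal.span S)).principal
  have hdvd : ∀ {a}, a ∈ S → n ∣ a := fun {a} ha => by
    rw [← Ideal.mem_span_singleton, ← hn]; exact Ideal.subset_span ha
  have hnorm : ∀ α ∈ I, ∃ a, E.emb a = α * E.conj α ∧ n ∣ a := fun α hα => by
    obtain ⟨a, ha⟩ := E.exists_emb_eq (α * E.conj α) (by rw [map_mul, E.conj_conj, mul_comm])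
    exact ⟨a, ha, hdvd ⟨α, hα, α, hα, Or.inr ha⟩⟩
  have hn0 : n ≠ 0 := by
    rintro rfl
    obtain ⟨α, hα, hα0⟩ := Submodule.exists_mem_ne_zero_of_ne_bot hI
    obtain ⟨a, ha, hna⟩ := hnorm α hα
    rw [zero_dvd_iff.mp hna, map_zero] at ha
    exact mul_ne_zero hα0 ((map_ne_zero_iff _ E.conj.injective).mpr hα0) ha.symm
  refine ⟨n, hn0, le_antisymm ?_ ?_⟩
  · rw [Ideal.mul_le]
    intro α hα s hs
    obtain ⟨β, hβ, rfl⟩ := E.mem_map_conj hs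
    rw [Ideal.mem_span_singleton]
    obtain ⟨a, ha, a', rfl⟩ := hnorm α hα
    obtain ⟨b, hb, b', rfl⟩ := hnorm β hβ
    obtain ⟨t, ht⟩ := E.exists_emb_eq (α * E.conj β + β * E.conj α) (by
      rw [map_add, map_mul, map_mul, E.conj_conj, E.conj_conj]; ring)
    refine IsIntegrallyClosed.dvd_of_dvd_add_of_sq_dvd_mul (v := β * E.conj α)
      (E.emb_ne_zero hn0) ?_ ?_
    · rw [← ht]
      exact map_dvd _ (hdvd ⟨α, hα, β, hβ, Or.inl ht⟩)
    · refine ⟨E.emb (a' * b'), ?_⟩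
      simp only [map_mul] at ha hb ⊢
      linear_combination -(α * E.conj α) * hb - E.emb n * E.emb b' * ha
  · have : (Ideal.span S).map E.emb ≤ I * I.map E.conj := by
      rw [Ideal.map_span, Ideal.span_le]
      rintro _ ⟨a, ⟨α, hα, β, hβ, h | h⟩, rfl⟩
      · rw [h]
        exact add_mem (Ideal.mul_mem_mul hα (Ideal.mem_map_of_mem _ hβ))
          (Ideal.mul_mem_mul hβ (Ideal.mem_map_of_mem _ hα))
      · rw [h]
        exact Ideal.mul_mem_mul hα (Ideal.mem_map_of_mem _ hα)
    rwa [hn, Ideal.map_span, Set.image_singleton] at this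

end QuadraticConj

theorem Ideal.sq_injective {R : Type*} [CommRing R] [IsDedekindDomain R] {I J : Ideal R}
    (h : I ^ 2 = J ^ 2) : I = J :=
  le_antisymm
    (Ideal.dvd_iff_le.mp ((UniqueFactorizationMonoid.pow_dvd_pow_iff_dvd two_ne_zero).mp h.symm.dvd))
    (Ideal.dvd_iff_le.mp ((UniqueFactorizationMonoid.pow_dvd_pow_iff_dvd two_ne_zero).mp h.dvd))

theorem Ideal.span_singleton_ne_zero {R : Type*} [CommRing R] {b : R} (hb : b ≠ 0) :
    Ideal.span {b} ≠ 0 := by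
  rwa [Ne, Ideal.zero_eq_bot, Ideal.span_singleton_eq_bot]

namespace QuadraticConj

open GaussianInt

variable {B : Type*} [CommRing B] [IsDedekindDomain B] {d : GaussianInt} (E : QuadraticConj B d)

theorem exists_sq_eq_span_emb_of_map_conj_eq {K : Ideal B} (hK : K ≠ 0)
    (h : K.map E.conj = K) : ∃ n, n ≠ 0 ∧ K ^ 2 = Ideal.span {E.emb n} := by
  obtain ⟨n, hn, h'⟩ := E.exists_mul_map_conj_eq hK
  rw [h, ← pow_two] at h'
  exact ⟨n, hn, h'⟩

/-- Up to principal ideals, an ideal with principal square has a square generated by an element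
of `ℤ[i]`. -/
theorem exists_sq_eq_span_emb (hd : d ≠ 0) (hi : ∀ k, IsNormForm d (imag ^ k) → Even k)
    {J : Ideal B} (hJ : J ≠ 0) {γ : B} (h : J ^ 2 = Ideal.span {γ}) :
    ∃ b, b ≠ 0 ∧ ∃ n, n ≠ 0 ∧ (Ideal.span {b} * J) ^ 2 = Ideal.span {E.emb n} := by
  obtain ⟨n, hn, hnJ⟩ := E.exists_mul_map_conj_eq hJ
  obtain ⟨N, hN⟩ := E.exists_emb_eq (γ * E.conj γ) (by rw [map_mul, E.conj_conj, mul_comm])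
  have h1 : Ideal.span {E.emb (n ^ 2)} = Ideal.span {E.emb N} := by
    rw [hN, ← Ideal.span_singleton_mul_span_singleton, ← E.map_conj_span, ← h, Ideal.map_pow,
      ← mul_pow, hnJ, Ideal.span_singleton_pow, map_pow]
  obtain ⟨k, hk⟩ := E.exists_emb_imag_pow_mul_eq (Ideal.span_singleton_eq_span_singleton.mp h1)
  have hnf := E.isNormForm hd hN
  rw [hk] at hnf
  obtain ⟨m, rfl⟩ := hi k (hnf.of_mul_sq hn)
  obtain ⟨n', hn'⟩ : ∃ n', n' = imag ^ m * n := ⟨_, rfl⟩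
  have hn'0 : n' ≠ 0 := by rw [hn']; exact mul_ne_zero (pow_ne_zero _ (by decide)) hn
  have hn'J : J * J.map E.conj = Ideal.span {E.emb n'} := by
    rw [hnJ, Ideal.span_singleton_eq_span_singleton, hn', map_mul]
    exact (associated_unit_mul_right _ _ ((isUnit_imag.pow m).map E.emb))
  have hγ : γ * E.conj γ = E.emb n' ^ 2 := by
    rw [← hN, hk, hn', ← map_pow]; congr 1; ring
  have hJγ : Ideal.span {E.emb n'} * J = Ideal.span {γ} * J.map E.conj := by
    rw [← h, ← hn'J]; ring
  by_cases hβ : E.emb n' + γ = 0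
  · refine ⟨1, one_ne_zero, E.exists_sq_eq_span_emb_of_map_conj_eq ?_ ?_⟩
    · rwa [Ideal.span_singleton_one, Ideal.one_eq_top.symm, one_mul]
    · rw [Ideal.span_singleton_one, Ideal.one_eq_top.symm, one_mul]
      rw [show γ = -E.emb n' by linear_combination hβ, Ideal.span_singleton_neg] at hJγ
      exact (mul_left_cancel₀ (Ideal.span_singleton_ne_zero (E.emb_ne_zero hn'0)) hJγ).symm
  · have hβ' : E.emb n' + E.conj γ ≠ 0 := by
      intro h0
      refine hβ ?_
      have := congrArg E.conj h0
      rwa [map_add, E.conj_conj, E.conj_emb, map_zero] at this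
    refine ⟨E.emb n' + E.conj γ, hβ', E.exists_sq_eq_span_emb_of_map_conj_eq
      (mul_ne_zero (Ideal.span_singleton_ne_zero hβ') hJ) ?_⟩
    refine mul_left_cancel₀ (Ideal.span_singleton_ne_zero (E.emb_ne_zero hn'0)) ?_
    rw [Ideal.map_mul, E.map_conj_span, ← mul_assoc, Ideal.span_singleton_mul_span_singleton,
      map_add, E.conj_conj, E.conj_emb,
      show E.emb n' * (E.emb n' + γ) = (E.emb n' + E.conj γ) * γ by linear_combination -hγ,
      ← Ideal.span_singleton_mul_span_singleton, mul_assoc, ← hJγ]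
    ring

theorem dvd_two_mul_of_sq_eq {r : GaussianInt} (hr : Squarefree r) {K : Ideal B}
    (h : K ^ 2 = Ideal.span {E.emb r}) {q : GaussianInt} (hq : Prime q) (hqr : q ∣ r) :
    q ∣ 2 * d := by
  by_contra hqd
  have hconj : K.map E.conj = K := by
    refine Ideal.sq_injective ?_
    rw [← Ideal.map_pow, h, E.map_conj_span, E.conj_emb]
  have hsq : ∀ z ∈ K, E.emb q ∣ z * E.conj z ∧ E.emb q ∣ z ^ 2 := fun z hz => by
    have hd : ∀ w ∈ K ^ 2, E.emb q ∣ w := fun w hw => by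
      rw [h, Ideal.mem_span_singleton] at hw
      exact (map_dvd E.emb hqr).trans hw
    refine ⟨hd _ ?_, hd _ (Ideal.pow_mem_pow hz 2)⟩
    rw [pow_two]
    refine Ideal.mul_mem_mul hz ?_
    have := Ideal.mem_map_of_mem E.conj hz
    rwa [hconj] at this
  have hKq : K ≤ Ideal.span {E.emb q} := by
    intro z hz
    obtain ⟨h1, h2⟩ := hsq z hz
    have h3 : E.emb q ∣ E.conj z ^ 2 := by
      have := map_dvd E.conj h2
      rwa [E.conj_emb, map_pow] at this
    obtain ⟨T, hT⟩ := E.exists_emb_eq (z + E.conj z) (by rw [map_add, E.conj_conj, add_comm])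
    obtain ⟨s, hs⟩ := E.exists_emb_eq ((z - E.conj z) * E.root) (by
      rw [map_mul, map_sub, E.conj_conj, E.conj_root]; ring)
    have hqT : q ∣ T := by
      refine hq.dvd_of_dvd_pow (n := 2) (E.emb_dvd_emb ?_)
      rw [map_pow, hT, show (z + E.conj z) ^ 2 = z ^ 2 + E.conj z ^ 2 + z * E.conj z * 2 by ring]
      exact dvd_add (dvd_add h2 h3) (h1.mul_right _)
    have hqs : q ∣ s := by
      refine hq.dvd_of_dvd_pow (n := 2) (E.emb_dvd_emb ?_)
      rw [map_pow, hs, show ((z - E.conj z) * E.root) ^ 2 =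
        (z ^ 2 + E.conj z ^ 2 - z * E.conj z * 2) * E.root ^ 2 by ring]
      exact (dvd_sub (dvd_add h2 h3) (h1.mul_right _)).mul_right _
    have h4 : E.emb q ∣ E.emb (2 * d) * z := by
      have : E.emb (2 * d) * z = E.emb d * E.emb T + E.emb s * E.root := by
        rw [hT, hs, map_mul, map_ofNat, ← E.root_sq]; ring
      rw [this]
      exact dvd_add ((map_dvd _ hqT).mul_left _) ((map_dvd _ hqs).mul_right _)
    obtain ⟨u, v, huv⟩ := (hq.irreducible.coprime_iff_not_dvd).mpr hqd
    rw [Ideal.mem_span_singleton]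
    have := congrArg E.emb huv
    rw [map_add, map_mul, map_mul E.emb v, map_one] at this
    have : z = E.emb q * (E.emb u * z) + E.emb v * (E.emb (2 * d) * z) := by
      linear_combination -z * this
    rw [this]
    exact dvd_add (dvd_mul_right _ _) (h4.mul_left _)
  have h5 := Ideal.pow_right_mono hKq 2
  rw [h, Ideal.span_singleton_pow, Ideal.span_singleton_le_span_singleton, ← map_pow] at h5
  have h6 := E.emb_dvd_emb h5
  rw [pow_two] at h6
  exact hq.not_isUnit (hr q h6)

theorem exists_eq_mul_sq_of_sq_eq {n : GaussianInt} (hn : n ≠ 0) {K : Ideal B}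
    (h : K ^ 2 = Ideal.span {E.emb n}) : ∃ r c, r ≠ 0 ∧ c ≠ 0 ∧ n = r * c ^ 2 ∧
      ∀ q, Prime q → q ∣ r → q ∣ 2 * d := by
  obtain ⟨r, c, hr, rfl⟩ := exists_eq_squarefree_mul_sq hn
  have hr0 : r ≠ 0 := left_ne_zero_of_mul hn
  have hc0 : c ≠ 0 := fun h => hn (by rw [h]; ring)
  refine ⟨r, c, hr0, hc0, rfl, fun q hq hqr => ?_⟩
  obtain ⟨K', rfl⟩ : Ideal.span {E.emb c} ∣ K := by
    refine (UniqueFactorizationMonoid.pow_dvd_pow_iff_dvd two_ne_zero).mp ?_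
    rw [h, Ideal.span_singleton_pow, Ideal.dvd_iff_le, Ideal.span_singleton_le_span_singleton,
      map_mul, map_pow]
    exact dvd_mul_left _ _
  refine E.dvd_two_mul_of_sq_eq hr (K := K') ?_ hq hqr
  refine mul_left_cancel₀ (pow_ne_zero 2 (Ideal.span_singleton_ne_zero (E.emb_ne_zero hc0))) ?_
  rw [← mul_pow, h, Ideal.span_singleton_pow, Ideal.span_singleton_mul_span_singleton, map_mul,
    map_pow, mul_comm]

end QuadraticConj

open GaussianInt

theorem GaussianInt.IsNormForm.mul_sq {d s : GaussianInt} (h : IsNormForm d s) (t : GaussianInt) :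
    IsNormForm d (s * t ^ 2) := by
  obtain ⟨X, Y, C, hC, h⟩ := h
  exact ⟨t * X, t * Y, C, hC, by linear_combination t ^ 2 * h⟩

section UnitMulSq

variable {R : Type*} [CommRing R] (f : GaussianInt →+* R)

theorem isUnitMulSq_map_two : IsUnitMulSq (f 2) := by
  rw [show (2 : GaussianInt) = imag ^ 3 * lam ^ 2 by decide, map_mul, map_pow f lam]
  exact (IsUnitMulSq.of_isUnit ((isUnit_imag.pow 3).map f)).mul (IsUnitMulSq.sq _)

variable [IsDomain R] [IsIntegrallyClosed R]

/-- If `x + y δ` has norm `-1` then `x + i` is a square up to a unit. -/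
theorem isUnitMulSq_map_add_imag (h2 : f 2 ≠ 0) {x y : ℤ} {δ : R}
    (h : (x : R) ^ 2 + 1 = δ ^ 2 * y ^ 2) : IsUnitMulSq (f (x + imag)) := by
  have hu : IsUnit (x + y * δ : R) :=
    IsUnit.of_mul_eq_one (-(x - y * δ)) (by linear_combination -h)
  have hi : f imag * f imag = -1 := by rw [← map_mul, imag_mul_imag, map_neg, map_one]
  refine IsUnitMulSq.of_mul h2 (isUnitMulSq_map_two f) ?_
  obtain ⟨u, hu⟩ := hu
  refine ⟨u⁻¹, x + f imag + y * δ, ?_⟩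
  rw [Units.eq_inv_mul_iff_mul_eq, hu, map_add, map_ofNat, map_intCast]
  linear_combination h - hi

end UnitMulSq

theorem Ideal.exists_eq_span_singleton_of_sq {R : Type*} [CommRing R] [IsDedekindDomain R]
    {J : Ideal R} {b n : R} (hb : b ≠ 0) (h : (Ideal.span {b} * J) ^ 2 = Ideal.span {n})
    (hn : IsUnitMulSq n) : ∃ y, J = Ideal.span {y} := by
  obtain ⟨w, κ, rfl⟩ := hn
  have h1 : Ideal.span {b} * J = Ideal.span {κ} := by
    refine Ideal.sq_injective ?_
    rw [h, Ideal.span_singleton_pow, Ideal.span_singleton_eq_span_singleton]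
    exact (associated_unit_mul_left _ _ w.isUnit)
  obtain ⟨y, rfl⟩ : b ∣ κ := by
    rw [← Ideal.span_singleton_le_span_singleton, ← h1]
    exact Ideal.mul_le_left
  refine ⟨y, mul_left_cancel₀ (Ideal.span_singleton_ne_zero hb) ?_⟩
  rw [h1, Ideal.span_singleton_mul_span_singleton]

namespace QuadraticConj

theorem isUnitMulSq_emb_mul {p q : ℕ} {B : Type*} [CommRing B] [IsDedekindDomain B]
    (E : QuadraticConj B (2 * p * q)) : IsUnitMulSq (E.emb (p * q)) := by
  refine IsUnitMulSq.of_mul (E.emb_ne_zero two_ne_zero) (isUnitMulSq_map_two E.emb) ?_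
  rw [← map_mul, show (p * q * 2 : GaussianInt) = 2 * p * q by ring, ← E.root_sq]
  exact IsUnitMulSq.sq _

variable {p q : ℕ} [Fact p.Prime] [Fact q.Prime]

theorem even_of_isNormForm_imag_pow (P : SplitPrime p) (Q : SplitPrime q) (hmp : p % 8 = 5) (hne : p ≠ q) {k : ℕ}
    (h : IsNormForm (2 * p * q) (imag ^ k)) : Even k := by
  have := P.symb_relation Q hmp hne (k := k) (e := 0) (f := 0) (e' := 0) (f' := 0) zero_le_one
    (by simpa using h)
  simp only [pow_zero, mul_one] at this
  exact (neg_one_pow_eq_one_iff_even (by norm_num)).mp this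

theorem two_mul_mul_ne_zero : (2 * p * q : GaussianInt) ≠ 0 := by
  have hp := (Fact.out : p.Prime).ne_zero
  have hq := (Fact.out : q.Prime).ne_zero
  exact_mod_cast mul_ne_zero (mul_ne_zero two_ne_zero hp) hq

variable {B : Type*} [CommRing B] [IsDedekindDomain B] (E : QuadraticConj B (2 * p * q))

theorem exists_eq_monomial_mul_sq (P : SplitPrime p) (Q : SplitPrime q) {n : GaussianInt} (hn : n ≠ 0) {K : Ideal B}
    (h : K ^ 2 = Ideal.span {E.emb n}) : ∃ k e₀ e f e' f' c, c ≠ 0 ∧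
      n = SplitPrime.monomial P Q k e₀ e f e' f' * c ^ 2 := by
  obtain ⟨r, c, hr, hc, rfl, hrp⟩ := E.exists_eq_mul_sq_of_sq_eq hn h
  obtain ⟨k, e₀, e, f, e', f', rfl⟩ := P.exists_eq_monomial Q hr fun z hz hzr => by
    rcases hz.dvd_or_dvd (hrp z hz hzr) with h | h
    · exact (h.mul_right _).mul_right _
    · exact h
  exact ⟨k, e₀, e, f, e', f', c, hc, rfl⟩

theorem isUnitMulSq_emb_of_isNormForm (hmp : p % 8 = 5) (hmq : q % 8 = 5) (hne : p ≠ q)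
    {n : GaussianInt} (hn : n ≠ 0) {K : Ideal B} (h : K ^ 2 = Ideal.span {E.emb n})
    (hnf : IsNormForm (2 * p * q) n) : IsUnitMulSq (E.emb n) := by
  obtain ⟨P⟩ := SplitPrime.nonempty (p := p) Fact.out (by omega)
  obtain ⟨Q⟩ := SplitPrime.nonempty (p := q) Fact.out (by omega)
  obtain ⟨x, y, hxy⟩ := exists_sq_add_one_eq_two_mul_mul_sq (p := p) (q := q) Fact.out Fact.out
    hmp hmq
  have hx : Odd x := by
    rcases Int.even_or_odd x with ⟨z, rfl⟩ | hx
    · have h1 : 2 * (2 * z ^ 2) + 1 = 2 * (p * q * y ^ 2) := by linear_combination hxy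
      omega
    · exact hx
  have hxyA : (x : GaussianInt) ^ 2 + 1 = 2 * p * q * y ^ 2 := by exact_mod_cast hxy
  have hm0 : (x + imag : GaussianInt) ≠ 0 := by
    intro h0
    have := (ext_iff'.mp h0).2
    simp [imag] at this
  have hm : IsUnitMulSq (E.emb (x + imag)) := by
    refine isUnitMulSq_map_add_imag E.emb (E.emb_ne_zero two_ne_zero) (y := y) (δ := E.root) ?_
    have := congrArg E.emb hxyA
    rw [map_mul, ← E.root_sq] at this
    simpa using this
  have hmnf : IsNormForm (2 * p * q) (x + imag) :=
    ⟨x + imag, y, lam, lam_ne_zero, by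
      rw [lam_sq]; linear_combination hxyA - imag_mul_imag⟩
  obtain ⟨K', hK'⟩ : ∃ K' : Ideal B, K' ^ 2 = Ideal.span {E.emb (x + imag)} := by
    obtain ⟨w, κ, hw⟩ := hm
    refine ⟨Ideal.span {κ}, ?_⟩
    rw [Ideal.span_singleton_pow, Ideal.span_singleton_eq_span_singleton, hw]
    exact (associated_unit_mul_left _ _ w.isUnit).symm
  obtain ⟨k₁, g₀, g, h', g', h'', c₁, hc₁, hm'⟩ := E.exists_eq_monomial_mul_sq P Q hm0 hK'
  have hg₀ := SplitPrime.odd_of_monomial_mul_sq_eq P Q (by omega) (by omega) hx hm'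
  obtain ⟨k, e₀, e, f, e', f', c, hc, hn'⟩ := E.exists_eq_monomial_mul_sq P Q hn h
  have hiu : ∀ j, IsUnitMulSq (E.emb (imag ^ j)) := fun j =>
    IsUnitMulSq.of_isUnit ((isUnit_imag.pow j).map _)
  have hpq := E.isUnitMulSq_emb_mul
  obtain ⟨j, b, hb, hcase⟩ := SplitPrime.eq_of_isNormForm P Q hmp hmq hne hc hc₁ hg₀
    (by rw [← hn']; exact hnf) (by rw [← hm']; exact hmnf)
  rw [← hn', ← hm'] at hcase
  rcases hcase with h | h | h | h
  · rw [h, map_mul, map_pow E.emb b]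
    exact (hiu j).mul (IsUnitMulSq.sq _)
  · rw [h, map_mul, map_mul, map_pow E.emb b]
    exact ((hiu j).mul hpq).mul (IsUnitMulSq.sq _)
  · refine IsUnitMulSq.of_mul (E.emb_ne_zero hm0) hm ?_
    rw [← map_mul, h, map_mul, map_pow E.emb b]
    exact (hiu j).mul (IsUnitMulSq.sq _)
  · refine IsUnitMulSq.of_mul (E.emb_ne_zero hm0) hm ?_
    rw [← map_mul, h, map_mul, map_mul, map_pow E.emb b]
    exact ((hiu j).mul hpq).mul (IsUnitMulSq.sq _)

/-- The class group has no elements of order `4`. -/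
theorem exists_sq_eq_span_of_pow_four (E : QuadraticConj B (2 * p * q)) (hmp : p % 8 = 5) (hmq : q % 8 = 5) (hne : p ≠ q)
    {I : Ideal B} (hI : I ≠ 0) {γ : B} (h : I ^ 4 = Ideal.span {γ}) :
    ∃ y, I ^ 2 = Ideal.span {y} := by
  obtain ⟨P⟩ := SplitPrime.nonempty (p := p) Fact.out (by omega)
  obtain ⟨Q⟩ := SplitPrime.nonempty (p := q) Fact.out (by omega)
  obtain ⟨b, hb, n, hn, hK⟩ := E.exists_sq_eq_span_emb two_mul_mul_ne_zero
    (fun k => even_of_isNormForm_imag_pow P Q hmp hne) (pow_ne_zero 2 hI)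
    (by rw [← pow_mul]; exact h)
  obtain ⟨m, hm, hIm⟩ := E.exists_mul_map_conj_eq hI
  obtain ⟨N, hN⟩ := E.exists_emb_eq (b * E.conj b) (by rw [map_mul, E.conj_conj, mul_comm])
  have hNnf := E.isNormForm two_mul_mul_ne_zero hN
  have h1 : Ideal.span {E.emb n} = Ideal.span {E.emb (N * m ^ 2)} := by
    refine Ideal.sq_injective ?_
    calc Ideal.span {E.emb n} ^ 2
        = (Ideal.span {b} * I ^ 2) ^ 2 * ((Ideal.span {b} * I ^ 2) ^ 2).map E.conj := by
          rw [hK, E.map_conj_span, E.conj_emb, pow_two]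
      _ = (Ideal.span {b} * Ideal.span {E.conj b} * (I * I.map E.conj) ^ 2) ^ 2 := by
          simp only [Ideal.map_pow, Ideal.map_mul, E.map_conj_span]; ring
      _ = _ := by
          rw [hIm, Ideal.span_singleton_mul_span_singleton, ← hN, Ideal.span_singleton_pow _ 2,
            Ideal.span_singleton_mul_span_singleton, map_mul, map_pow]
  obtain ⟨k, hk⟩ := E.exists_emb_imag_pow_mul_eq (Ideal.span_singleton_eq_span_singleton.mp h1)
  have hnf : IsNormForm (2 * p * q) (imag ^ k * n) := by
    rw [← hk]; exact hNnf.mul_sq m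
  have hu : IsUnitMulSq (E.emb (N * m ^ 2)) := by
    rw [h1] at hK
    refine E.isUnitMulSq_emb_of_isNormForm hmp hmq hne ?_ hK (hNnf.mul_sq m)
    rw [hk]
    exact mul_ne_zero (pow_ne_zero _ (by decide)) hn
  rw [h1] at hK
  exact Ideal.exists_eq_span_singleton_of_sq hb hK hu

theorem exists_sq_eq_span_of_pow_two_pow (E : QuadraticConj B (2 * p * q)) (hmp : p % 8 = 5) (hmq : q % 8 = 5) (hne : p ≠ q)
    {I : Ideal B} (hI : I ≠ 0) (k : ℕ) :
    ∀ {γ : B}, I ^ 2 ^ k = Ideal.span {γ} → ∃ y, I ^ 2 = Ideal.span {y} := by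
  induction k with
  | zero =>
    intro γ h
    rw [pow_zero, pow_one] at h
    exact ⟨γ ^ 2, by rw [h, Ideal.span_singleton_pow]⟩
  | succ k ih =>
    intro γ h
    rcases k with _ | k
    · exact ⟨γ, h⟩
    · rw [show 2 ^ (k + 1 + 1) = 2 ^ k * 4 by ring, pow_mul] at h
      obtain ⟨y, hy⟩ := E.exists_sq_eq_span_of_pow_four hmp hmq hne (pow_ne_zero _ hI) h
      refine ih (γ := y) ?_
      rw [← hy, ← pow_mul, pow_succ]

end QuadraticConj

section UnitMulSq

variable {R : Type*} [CommRing R] {f : GaussianInt →+* R}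

theorem isUnitMulSq_map_lam {ζ : R} (hζ : ζ ^ 2 = f imag) :
    IsUnitMulSq (f lam) := by
  have hi : f imag * f imag = -1 := by rw [← map_mul, imag_mul_imag, map_neg, map_one]
  have hu : IsUnit (1 + ζ * (1 - f imag)) :=
    IsUnit.of_mul_eq_one (ζ * (1 - f imag) - 1) (by
      linear_combination (1 - f imag) ^ 2 * hζ + (f imag - 2) * hi)
  obtain ⟨u, hu⟩ := hu
  refine ⟨u⁻¹, 1 + ζ, ?_⟩
  rw [Units.eq_inv_mul_iff_mul_eq, hu, lam_eq, map_add, map_one]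
  linear_combination -hζ - ζ * hi

namespace GaussianInt.SplitPrime

variable [IsDomain R] [IsIntegrallyClosed R] {p : ℕ} [Fact p.Prime] (P : SplitPrime p)

theorem isUnitMulSq_map_gen_of_dvd (hf : Function.Injective f) (hm : p % 4 = 1) {δ : R}
    (hδ : δ ^ 2 = p) {x y : ℤ} (h : x ^ 2 + 1 = p * y ^ 2) (hd : P.gen ∣ x + imag) :
    IsUnitMulSq (f P.gen) := by
  have h2 : f 2 ≠ 0 := (map_ne_zero_iff f hf).mpr two_ne_zero
  have hz : IsUnitMulSq (f (x + imag)) := by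
    refine isUnitMulSq_map_add_imag f h2 (y := y) (δ := δ) ?_
    rw [hδ]; exact_mod_cast congrArg (Int.cast : ℤ → R) h
  have hx : Even x := by
    rcases Int.even_or_odd x with hx | hx
    · exact hx
    · exfalso
      have h1 := Int.sq_mod_four_eq_one_of_odd hx
      rcases Int.even_or_odd y with ⟨z, rfl⟩ | hy
      · have : x ^ 2 + 1 = 4 * (p * z ^ 2) := by rw [h]; ring
        omega
      · have : Odd (p * y ^ 2 : ℤ) := by
          refine Odd.mul ?_ hy.pow
          rw [Int.odd_iff]; omega
        rw [← h, Int.odd_iff] at this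
        omega
  obtain ⟨w, rfl⟩ := hx
  obtain ⟨t, ht⟩ := hd
  have hst : star (((w + w : ℤ) : GaussianInt) + imag) = star P.gen * star t := by
    rw [ht, star_mul']
  have hs : star (((w + w : ℤ) : GaussianInt) + imag) = ((w + w : ℤ) : GaussianInt) - imag := by
    rw [star_add, star_intCast, show star imag = -imag by decide, sub_eq_add_neg]
  have hcop : IsCoprime (((w + w : ℤ) : GaussianInt) + imag)
      (star (((w + w : ℤ) : GaussianInt) + imag)) := by
    rw [hs]
    refine ⟨(w + w : ℤ) - imag + 2 * w ^ 2 * imag, -(2 * w ^ 2 * imag), ?_⟩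
    push_cast
    linear_combination (4 * (w : GaussianInt) ^ 2 - 1) * imag_mul_imag
  have htt : t * star t = (y : GaussianInt) ^ 2 := by
    have hA : (((w + w : ℤ) : GaussianInt)) ^ 2 + 1 = p * y ^ 2 := by exact_mod_cast h
    have hp0 : (p : GaussianInt) ≠ 0 := by exact_mod_cast (Fact.out : p.Prime).ne_zero
    refine mul_left_cancel₀ hp0 ?_
    rw [← hA, ← P.gen_mul_star]
    calc _ = (P.gen * t) * (star P.gen * star t) := by ring
      _ = _ := by
        rw [← ht, ← hst, hs]; linear_combination -imag_mul_imag
  have htc : IsCoprime t (star t) := by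
    rw [hst, ht] at hcop
    exact hcop.of_mul_left_right.of_mul_right_right
  obtain ⟨s, u, hu⟩ := exists_associated_pow_of_mul_eq_pow' htc htt
  have ht0 : t ≠ 0 := by
    rintro rfl
    rw [mul_zero] at ht
    have := (ext_iff'.mp ht).2
    simp [imag] at this
  refine IsUnitMulSq.of_mul ((map_ne_zero_iff f hf).mpr ht0) ?_ (by rw [← map_mul, ← ht]; exact hz)
  rw [← hu, map_mul, map_pow]
  exact (IsUnitMulSq.sq _).mul (IsUnitMulSq.of_isUnit (u.isUnit.map f))

theorem isUnitMulSq_map_gen (hf : Function.Injective f) (hm : p % 4 = 1) {δ : R}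
    (hδ : δ ^ 2 = p) : IsUnitMulSq (f P.gen) := by
  obtain ⟨x, y, h⟩ := exists_sq_add_one_eq_mul_sq_of_prime (p := p) Fact.out hm
  have hd : P.gen ∣ (x + imag) * (((-x : ℤ) : GaussianInt) + imag) := by
    refine ⟨-(star P.gen * y ^ 2), ?_⟩
    have hA : (x : GaussianInt) ^ 2 + 1 = p * y ^ 2 := by exact_mod_cast h
    rw [← P.gen_mul_star] at hA
    push_cast
    linear_combination imag_mul_imag - hA
  rcases P.prime_gen.dvd_or_dvd hd with hd | hd
  · exact P.isUnitMulSq_map_gen_of_dvd hf hm hδ h hd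
  · exact P.isUnitMulSq_map_gen_of_dvd hf hm hδ (by rw [← h]; ring) hd

variable {q : ℕ} [Fact q.Prime] (Q : SplitPrime q)

theorem isUnitMulSq_map_monomial (hf : Function.Injective f) (hp : p % 4 = 1) (hq : q % 4 = 1)
    {ζ δ ε : R} (hζ : ζ ^ 2 = f imag) (hδ : δ ^ 2 = p) (hε : ε ^ 2 = q) (k e₀ e g e' g' : ℕ) :
    IsUnitMulSq (f (monomial P Q k e₀ e g e' g')) := by
  have hP := P.isUnitMulSq_map_gen hf hp hδ
  have hP' := P.conj.isUnitMulSq_map_gen hf hp hδ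
  have hQ := Q.isUnitMulSq_map_gen hf hq hε
  have hQ' := Q.conj.isUnitMulSq_map_gen hf hq hε
  simp only [monomial, map_mul, map_pow]
  exact ((((((IsUnitMulSq.of_isUnit (isUnit_imag.map f)).pow k).mul
    ((isUnitMulSq_map_lam hζ).pow e₀)).mul (hP.pow e)).mul (hP'.pow g)).mul (hQ.pow e')).mul
    (hQ'.pow g')

end GaussianInt.SplitPrime

end UnitMulSq

namespace QuadraticConj

variable {p q : ℕ} [Fact p.Prime] [Fact q.Prime] {B C : Type*} [CommRing B] [IsDedekindDomain B]
  [CommRing C] [IsDedekindDomain C]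

/-- Ideals with class of `2`-power order become principal in an extension containing square
roots of `i`, `p` and `q`. -/
theorem exists_map_eq_span (E : QuadraticConj B (2 * p * q)) (hmp : p % 8 = 5) (hmq : q % 8 = 5)
    (hne : p ≠ q) {φ : B →+* C} (hφ : Function.Injective φ) {ζ δ ε : C}
    (hζ : ζ ^ 2 = φ (E.emb imag)) (hδ : δ ^ 2 = p) (hε : ε ^ 2 = q)
    {I : Ideal B} (hI : I ≠ 0) {k : ℕ} {γ : B} (h : I ^ 2 ^ k = Ideal.span {γ}) :
    ∃ y, I.map φ = Ideal.span {y} := by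
  obtain ⟨P⟩ := SplitPrime.nonempty (p := p) Fact.out (by omega)
  obtain ⟨Q⟩ := SplitPrime.nonempty (p := q) Fact.out (by omega)
  obtain ⟨γ', h'⟩ := E.exists_sq_eq_span_of_pow_two_pow hmp hmq hne hI k h
  obtain ⟨b, hb, n, hn, hK⟩ := E.exists_sq_eq_span_emb two_mul_mul_ne_zero
    (fun k => even_of_isNormForm_imag_pow P Q hmp hne) hI h'
  obtain ⟨k, e₀, e, f, e', f', c, hc, rfl⟩ := E.exists_eq_monomial_mul_sq P Q hn hK
  refine Ideal.exists_eq_span_singleton_of_sq (b := φ b) ((map_ne_zero_iff φ hφ).mpr hb)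
    (n := φ (E.emb (SplitPrime.monomial P Q k e₀ e f e' f' * c ^ 2))) ?_ ?_
  · have := congrArg (Ideal.map φ) hK
    rw [Ideal.map_pow, Ideal.map_mul, Ideal.map_span, Ideal.map_span, Set.image_singleton,
      Set.image_singleton] at this
    exact this
  · rw [map_mul, map_mul, map_pow, map_pow]
    refine IsUnitMulSq.mul ?_ (IsUnitMulSq.sq _)
    exact P.isUnitMulSq_map_monomial Q (f := φ.comp E.emb) (hφ.comp E.emb_injective)
      (by omega) (by omega) hζ hδ hε k e₀ e f e' f'

end QuadraticConj

open NumberField IntermediateField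

/-- An element of `ℚ(i)` which is integral over `ℤ` lies in `ℤ[i]`. -/
theorem GaussianInt.exists_map_eq_of_isIntegral {K : Type*} [Field K] {f : GaussianInt →+* K}
    (hf : Function.Injective f) {z : K} (hz : IsIntegral ℤ z) {m u : GaussianInt} (hm : m ≠ 0)
    (h : f m * z = f u) : ∃ w, f w = z := by
  let F := FractionRing GaussianInt
  let g : F →+* K := IsFractionRing.lift hf
  have hg : ∀ a, g (algebraMap GaussianInt F a) = f a := IsFractionRing.lift_algebraMap hf
  have hm' : f m ≠ 0 := (map_ne_zero_iff f hf).mpr hm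
  have hgz : g (algebraMap GaussianInt F u / algebraMap GaussianInt F m) = z := by
    rw [map_div₀, hg, hg, div_eq_iff hm', ← h, mul_comm]
  have hint : IsIntegral GaussianInt (algebraMap GaussianInt F u / algebraMap GaussianInt F m) := by
    obtain ⟨P, hP, hPz⟩ := hz
    refine ⟨P.map (Int.castRingHom GaussianInt), hP.map _, g.injective ?_⟩
    rw [Polynomial.eval₂_map, Polynomial.hom_eval₂, hgz, map_zero, ← hPz]
    congr 1
    exact Subsingleton.elim _ _
  obtain ⟨w, hw⟩ := IsIntegrallyClosed.isIntegral_iff.mp hint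
  exact ⟨w, by rw [← hg, hw, hgz]⟩

theorem IntermediateField.exists_eq_add_mul_of_mem_adjoin_simple {F K : Type*} [Field F] [Field K]
    [Algebra F K] {x : K} {d : F} (hx : x ^ 2 = algebraMap F K d) {z : K}
    (hz : z ∈ F⟮x⟯) : ∃ a b : F, z = algebraMap F K a + algebraMap F K b * x := by
  have hint : IsIntegral F x := IsIntegral.of_pow two_pos (by rw [hx]; exact isIntegral_algebraMap)
  rw [← mem_toSubalgebra, adjoin_simple_toSubalgebra_of_isAlgebraic hint.isAlgebraic] at hz
  induction hz using Algebra.adjoin_induction with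
  | mem y hy => exact ⟨0, 1, by rw [Set.mem_singleton_iff.mp hy]; simp⟩
  | algebraMap r => exact ⟨r, 0, by simp⟩
  | add y z _ _ hy hz =>
    obtain ⟨a, b, rfl⟩ := hy
    obtain ⟨a', b', rfl⟩ := hz
    exact ⟨a + a', b + b', by simp only [map_add]; ring⟩
  | mul y z _ _ hy hz =>
    obtain ⟨a, b, rfl⟩ := hy
    obtain ⟨a', b', rfl⟩ := hz
    exact ⟨a * a' + b * b' * d, a * b' + b * a', by
      simp only [map_add, map_mul]; linear_combination (algebraMap F K b * algebraMap F K b') * hx⟩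

/-- A quadratic extension generated by a square root has a conjugation. -/
theorem IntermediateField.exists_algHom_eq_neg {F K : Type*} [Field F] [Field K] [Algebra F K]
    {x : K} {d : F} (hx : x ^ 2 = algebraMap F K d) (hd : ∀ b : F, b ^ 2 ≠ d)
    (htop : F⟮x⟯ = ⊤) : ∃ σ : K →ₐ[F] K, σ x = -x := by
  have hmin : minpoly F x = Polynomial.X ^ 2 - Polynomial.C d :=
    (minpoly.eq_of_irreducible_of_monic (X_pow_sub_C_irreducible_of_prime Nat.prime_two hd)
      (by simp [hx]) (by monicity!)).symm
  refine exists_algHom_of_adjoin_splits_of_aeval (S := {x}) (fun s hs => ?_) htop ?_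
  · rw [Set.mem_singleton_iff.mp hs]
    refine ⟨IsIntegral.of_pow two_pos (by rw [hx]; exact isIntegral_algebraMap), ?_⟩
    have : Polynomial.map (algebraMap F K) (minpoly F x) =
        (Polynomial.X - Polynomial.C x) * (Polynomial.X - Polynomial.C (-x)) := by
      rw [hmin]
      simp only [Polynomial.map_sub, Polynomial.map_pow, Polynomial.map_X, Polynomial.map_C,
        ← hx, map_neg, map_pow]
      ring
    rw [this]
    exact (Polynomial.Splits.X_sub_C _).mul (Polynomial.Splits.X_sub_C _)
  · simp [hmin, hx]

theorem exists_quadraticConj {K : Type*} [Field K] [NumberField K] {i r : K} {D : ℕ}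
    (hi : i ^ 2 = -1) (hr : r ^ 2 = D) (hne : ∀ a b : ℚ, a + b * i ≠ r)
    (hrep : ∀ z : K, ∃ a b c e : ℚ, z = (a + b * i) + (c + e * i) * r) :
    ∃ E : QuadraticConj (𝓞 K) D, (E.emb imag : K) = i := by
  have hiF : i ^ 2 = algebraMap ℚ K (-1) := by simpa using hi
  let F : IntermediateField ℚ K := ℚ⟮i⟯
  have hmemF : ∀ a b : ℚ, (a + b * i : K) ∈ F := fun a b =>
    add_mem (F.algebraMap_mem a) (mul_mem (F.algebraMap_mem b) (mem_adjoin_simple_self ℚ i))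
  have hrepF : ∀ z : F, ∃ a b : ℚ, (z : K) = a + b * i := fun z =>
    exists_eq_add_mul_of_mem_adjoin_simple hiF z.2
  have htop : F⟮r⟯ = ⊤ := by
    refine eq_top_iff.mpr fun z _ => ?_
    obtain ⟨a, b, c, e, rfl⟩ := hrep z
    exact add_mem (F⟮r⟯.algebraMap_mem ⟨_, hmemF a b⟩)
      (mul_mem (F⟮r⟯.algebraMap_mem ⟨_, hmemF c e⟩) (mem_adjoin_simple_self F r))
  obtain ⟨σ, hσ⟩ := exists_algHom_eq_neg (F := F) (x := r) (d := (D : F)) (by simpa using hr)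
    (fun b hb => by
      obtain ⟨x, y, hxy⟩ := hrepF b
      have hb' : (b : K) ^ 2 = D := by
        have := congrArg (algebraMap F K) hb
        simpa using this
      rw [← hr, sq_eq_sq_iff_eq_or_eq_neg] at hb'
      rcases hb' with h | h
      · exact hne x y (by rw [← hxy, h])
      · refine hne (-x) (-y) ?_
        push_cast
        linear_combination hxy - h) htop
  have hσF : ∀ a b : ℚ, σ (a + b * i) = a + b * i := fun a b => σ.commutes ⟨_, hmemF a b⟩
  have hσrep : ∀ a b c e : ℚ, σ ((a + b * i) + (c + e * i) * r) =
      (a + b * i) - (c + e * i) * r := fun a b c e => by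
    rw [map_add, map_mul, hσF, hσF, hσ]; ring
  have hσσ : ∀ z, σ (σ z) = z := fun z => by
    obtain ⟨a, b, c, e, rfl⟩ := hrep z
    rw [hσrep, map_sub, map_mul, hσF, hσF, hσ]; ring
  have hr0 : r ≠ 0 := fun h => hne 0 0 (by simp [h])
  have hfix : ∀ z, σ z = z → ∃ a b : ℚ, z = a + b * i := fun z hz => by
    obtain ⟨a, b, c, e, rfl⟩ := hrep z
    rw [hσrep] at hz
    have : (c + e * i : K) = 0 := by
      have h0 : 2 * r * (c + e * i : K) = 0 := by linear_combination -hz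
      exact (mul_eq_zero.mp h0).resolve_left (mul_ne_zero two_ne_zero hr0)
    exact ⟨a, b, by rw [this]; ring⟩
  let iO : 𝓞 K := ⟨i, IsIntegral.of_pow two_pos (by rw [hi]; exact isIntegral_one.neg)⟩
  let rO : 𝓞 K := ⟨r, IsIntegral.of_pow two_pos (by rw [hr]; exact isIntegral_natCast D)⟩
  have hiO : iO * iO = ((-1 : ℤ) : 𝓞 K) := by
    ext
    change i * i = _
    rw [← pow_two, hi]; simp
  let f : GaussianInt →+* 𝓞 K := Zsqrtd.lift ⟨iO, hiO⟩
  have hf : ∀ a : GaussianInt, (f a : K) = a.re + a.im * i := fun a => by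
    change algebraMap (𝓞 K) K (a.re + a.im * iO) = _
    rw [map_add, map_mul, map_intCast, map_intCast]
    rfl
  have hfinj : Function.Injective f := Zsqrtd.lift_injective _ fun n => by
    nlinarith [mul_self_nonneg n]
  let σK : K ≃+* K := RingEquiv.ofRingHom (σ : K →+* K) (σ : K →+* K)
    (RingHom.ext hσσ) (RingHom.ext hσσ)
  refine ⟨⟨f, hfinj, RingOfIntegers.mapRingEquiv σK, fun z => RingOfIntegers.ext (hσσ z),
    fun a => RingOfIntegers.ext ?_, fun z hz => ?_, rO, RingOfIntegers.ext ?_,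
    RingOfIntegers.ext ?_⟩, ?_⟩
  · change σ (f a) = f a
    rw [hf]
    exact_mod_cast hσF a.re a.im
  · obtain ⟨a, b, hab⟩ := hfix z (congrArg (algebraMap (𝓞 K) K) hz)
    have hinj : Function.Injective ((algebraMap (𝓞 K) K).comp f) :=
      (FaithfulSMul.algebraMap_injective (𝓞 K) K).comp hfinj
    obtain ⟨w, hw⟩ := exists_map_eq_of_isIntegral hinj z.2
      (m := ((a.den * b.den : ℕ) : GaussianInt)) (u := ⟨a.num * b.den, b.num * a.den⟩)
      (by exact_mod_cast mul_ne_zero a.den_nz b.den_nz) (by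
        have ha : (a : K) * a.den = a.num := by exact_mod_cast a.mul_den_eq_num
        have hb : (b : K) * b.den = b.num := by exact_mod_cast b.mul_den_eq_num
        change _ * (z : K) = _
        rw [hab, map_natCast, RingHom.comp_apply]
        change _ = (f _ : K)
        rw [hf]
        push_cast
        linear_combination (b.den : K) * ha + (a.den : K) * i * hb)
    exact ⟨w, RingOfIntegers.ext hw⟩
  · change r ^ 2 = algebraMap (𝓞 K) K (f D)
    rw [map_natCast f, hr, map_natCast]
  · exact hσ
  · change (f imag : K) = i
    rw [hf]; simp [imag]

theorem NumberField.RingOfIntegers.exists_sq_eq {K : Type*} [Field K] {y : 𝓞 K} {x : K}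
    (h : x ^ 2 = y) : ∃ δ : 𝓞 K, δ ^ 2 = y :=
  ⟨⟨x, IsIntegral.of_pow two_pos (by rw [h]; exact y.2)⟩, RingOfIntegers.ext h⟩

theorem Complex.exists_eq_of_mem_adjoin {r : ℝ} {D : ℕ} (hr : r ^ 2 = D) {z : ℂ}
    (hz : z ∈ ℚ⟮(r : ℂ), Complex.I⟯) :
    ∃ a b c e : ℚ, z = (a + b * Complex.I) + (c + e * Complex.I) * r := by
  have hr' : (r : ℂ) ^ 2 = D := by exact_mod_cast congrArg (fun t : ℝ => (t : ℂ)) hr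
  have halg : ∀ x ∈ ({(r : ℂ), Complex.I} : Set ℂ), IsAlgebraic ℚ x := by
    rintro x (rfl | rfl)
    · exact (IsIntegral.of_pow two_pos
        (by rw [hr']; exact isIntegral_natCast D)).isAlgebraic
    · exact (IsIntegral.of_pow two_pos
        (by rw [Complex.I_sq]; exact isIntegral_one.neg)).isAlgebraic
  rw [← mem_toSubalgebra, adjoin_toSubalgebra_of_isAlgebraic halg] at hz
  induction hz using Algebra.adjoin_induction with
  | mem y hy =>
    rcases hy with rfl | rfl
    · exact ⟨0, 0, 1, 0, by simp⟩
    · exact ⟨0, 1, 0, 0, by simp⟩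
  | algebraMap t => exact ⟨t, 0, 0, 0, by simp⟩
  | add y z _ _ hy hz =>
    obtain ⟨a, b, c, e, rfl⟩ := hy
    obtain ⟨a', b', c', e', rfl⟩ := hz
    exact ⟨a + a', b + b', c + c', e + e', by push_cast; ring⟩
  | mul y z _ _ hy hz =>
    obtain ⟨a, b, c, e, rfl⟩ := hy
    obtain ⟨a', b', c', e', rfl⟩ := hz
    refine ⟨a * a' - b * b' + (c * c' - e * e') * D, a * b' + b * a' + (c * e' + e * c') * D,
      a * c' - b * e' + c * a' - e * b', a * e' + b * c' + c * b' + e * a', ?_⟩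
    push_cast
    linear_combination (b * b' + (b * e' + e * b') * (r : ℂ) + e * e' * (r : ℂ) ^ 2) *
      Complex.I_sq + (c * c' - e * e' + (c * e' + e * c') * Complex.I) * hr'

/-- The 2-class group of `𝕜 = ℚ(√(2p₁p₂), i)` capitulates completely in the
genus field `L₁ = ℚ(i, √2, √p₁, √p₂)`: for every nonzero ideal `I` of `𝓞_𝕜` whose class in
the class group has 2-power order, the ideal `I·𝓞_{L₁}` generated by the image of `I` (under
any ring homomorphism `𝓞_𝕜 → 𝓞_{L₁}` compatible with the embeddings into `ℂ`, i.e. the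
inclusion) is principal. -/
theorem stmt_19 (p₁ p₂ : ℕ) (hp₁ : p₁.Prime) (hp₂ : p₂.Prime) (hne : p₁ ≠ p₂)
    (hm₁ : p₁ % 8 = 5) (hm₂ : p₂ % 8 = 5)
    (𝕜 L₁ : IntermediateField ℚ ℂ)
    (h𝕜 : 𝕜 = ℚ⟮((Real.sqrt (2 * (p₁ : ℝ) * p₂) : ℝ) : ℂ), Complex.I⟯)
    (hL₁ : L₁ = ℚ⟮Complex.I, ((Real.sqrt 2 : ℝ) : ℂ), ((Real.sqrt (p₁ : ℝ) : ℝ) : ℂ),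
      ((Real.sqrt (p₂ : ℝ) : ℝ) : ℂ)⟯)
    [NumberField 𝕜] [NumberField L₁]
    (φ : RingOfIntegers 𝕜 →+* RingOfIntegers L₁)
    (hφ : ∀ z : RingOfIntegers 𝕜,
      ((algebraMap (RingOfIntegers L₁) L₁ (φ z) : L₁) : ℂ)
        = ((algebraMap (RingOfIntegers 𝕜) 𝕜 z : 𝕜) : ℂ)) :
    ∀ (I : Ideal (RingOfIntegers 𝕜)) (hI : I ≠ 0),
      (∃ k : ℕ, orderOf (ClassGroup.mk0 ⟨I, mem_nonZeroDivisors_of_ne_zero hI⟩) = 2 ^ k) →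
      (Ideal.map φ I).IsPrincipal := by
  rintro I hI ⟨k, hk⟩
  have := Fact.mk hp₁
  have := Fact.mk hp₂
  have hsq : Real.sqrt (2 * (p₁ : ℝ) * p₂) ^ 2 = (2 * p₁ * p₂ : ℕ) := by
    rw [Real.sq_sqrt (by positivity)]; push_cast; rfl
  have hirr : Irrational (Real.sqrt (2 * (p₁ : ℝ) * p₂)) := by
    have : Irrational (Real.sqrt ((2 * p₁ * p₂ : ℕ) : ℝ)) := by
      rw [irrational_sqrt_natCast_iff]
      rintro ⟨m, hm⟩
      rcases Nat.even_or_odd m with ⟨t, rfl⟩ | hodd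
      · have : p₁ * p₂ = 2 * (t * t) := by linarith
        have ho : Odd (p₁ * p₂) :=
          (Nat.odd_iff.mpr (by omega)).mul (Nat.odd_iff.mpr (by omega))
        rw [Nat.odd_iff] at ho
        omega
      · have ho := hodd.mul hodd
        rw [← hm, mul_assoc, Nat.odd_iff] at ho
        omega
    exact_mod_cast this
  have hmem : ((Real.sqrt (2 * (p₁ : ℝ) * p₂) : ℝ) : ℂ) ∈ 𝕜 ∧ Complex.I ∈ 𝕜 := by
    rw [h𝕜]
    exact ⟨subset_adjoin _ _ (by simp), subset_adjoin _ _ (by simp)⟩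
  generalize Real.sqrt (2 * (p₁ : ℝ) * p₂) = r at h𝕜 hsq hirr hmem
  have hE := exists_quadraticConj (K := 𝕜) (i := ⟨Complex.I, hmem.2⟩)
    (r := ⟨(r : ℂ), hmem.1⟩) (D := 2 * p₁ * p₂)
    (Subtype.ext (by simp))
    (Subtype.ext (Eq.trans (b := ((2 * p₁ * p₂ : ℕ) : ℂ)) (by
      change (r : ℂ) ^ 2 = _
      exact_mod_cast congrArg (fun t : ℝ => (t : ℂ)) hsq)
      (map_natCast 𝕜.val (2 * p₁ * p₂)).symm))
    (fun a b h => by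
      have h' : (a : ℂ) + b * Complex.I = r := by simpa using congrArg (Subtype.val) h
      refine hirr ⟨a, ?_⟩
      simpa using congrArg Complex.re h')
    (fun z => by
      obtain ⟨a, b, c, e, h⟩ := Complex.exists_eq_of_mem_adjoin hsq (h𝕜.le z.2)
      exact ⟨a, b, c, e, Subtype.ext (by simpa using h)⟩)
  rw [show ((2 * p₁ * p₂ : ℕ) : GaussianInt) = 2 * p₁ * p₂ by push_cast; rfl] at hE
  obtain ⟨E, hE⟩ := hE
  have hφinj : Function.Injective φ := fun z w h => by
    refine RingOfIntegers.ext (Subtype.ext ?_)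
    rw [← hφ, ← hφ, h]
  have hI₁ : Complex.I ∈ L₁ := by rw [hL₁]; exact subset_adjoin _ _ (by simp)
  have h2₁ : ((Real.sqrt 2 : ℝ) : ℂ) ∈ L₁ := by rw [hL₁]; exact subset_adjoin _ _ (by simp)
  have hp₁₁ : ((Real.sqrt p₁ : ℝ) : ℂ) ∈ L₁ := by rw [hL₁]; exact subset_adjoin _ _ (by simp)
  have hp₂₁ : ((Real.sqrt p₂ : ℝ) : ℂ) ∈ L₁ := by rw [hL₁]; exact subset_adjoin _ _ (by simp)
  have hsqrt : ∀ n : ℕ, ((Real.sqrt n : ℝ) : ℂ) ^ 2 = n := fun n => by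
    exact_mod_cast congrArg (fun t : ℝ => (t : ℂ)) (Real.sq_sqrt (Nat.cast_nonneg n))
  obtain ⟨δ, hδ⟩ := RingOfIntegers.exists_sq_eq (y := (p₁ : 𝓞 L₁)) (x := ⟨_, hp₁₁⟩)
    (Subtype.ext (by simpa using hsqrt p₁))
  obtain ⟨ε, hε⟩ := RingOfIntegers.exists_sq_eq (y := (p₂ : 𝓞 L₁)) (x := ⟨_, hp₂₁⟩)
    (Subtype.ext (by simpa using hsqrt p₂))
  obtain ⟨ζ, hζ⟩ := RingOfIntegers.exists_sq_eq (y := φ (E.emb imag))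
    (x := ⟨_, div_mem (add_mem (one_mem L₁) hI₁) h2₁⟩) (Subtype.ext (by
      refine Eq.trans ?_ ((congrArg Subtype.val hE).symm.trans (hφ _).symm)
      have h2 : ((Real.sqrt 2 : ℝ) : ℂ) ^ 2 = 2 := by simpa using hsqrt 2
      change ((1 + Complex.I) / ((Real.sqrt 2 : ℝ) : ℂ)) ^ 2 = Complex.I
      rw [div_pow, h2]
      linear_combination (1 / 2 : ℂ) * Complex.I_sq))
  have hprin : (I ^ 2 ^ k).IsPrincipal := by
    have h := pow_orderOf_eq_one (ClassGroup.mk0 ⟨I, mem_nonZeroDivisors_of_ne_zero hI⟩)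
    rw [hk, ← map_pow, ClassGroup.mk0_eq_one_iff] at h
    simpa using h
  obtain ⟨γ, hγ⟩ := hprin.principal
  obtain ⟨y, hy⟩ := E.exists_map_eq_span hm₁ hm₂ hne hφinj hζ hδ hε hI hγ
  exact ⟨⟨y, hy⟩⟩
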